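/- Fix c > 0. There exists a constant C > 0 (depending only on c) such that for every integer N ≥ 2, with probability at least 1 − C/N one has |m*(c,N) − (c/(c + 1/2))·N| ≤ C·√(N·log N). -/

import Mathlib

open MeasureTheory

/-- The maximum matching size between the points `X 0, …, X (k-1)` and
`Y 0, …, Y (k'-1)` with threshold `r`. -/
noncomputable def mmSize (r : ℝ) {k k' : ℕ} (X : Fin k → ℝ) (Y : Fin k' → ℝ) : ℕ :=
  sSup {j : ℕ | ∃ σ : Fin j → Fin k, ∃ τ : Fin j → Fin k',
    Function.Injective σ ∧ Function.Injective τ ∧ ∀ i, |X (σ i) - Y (τ i)| < r}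

/-- The product of `N` copies of the uniform distribution on `[0,1]`. -/
noncomputable def unifCube (N : ℕ) : Measure (Fin N → ℝ) :=
  Measure.pi fun _ => volume.restrict (Set.Icc 0 1)

/-! ### Combinatorics of matchings -/

/-- A set of index pairs that is a valid partial matching. -/
def PM (r : ℝ) {k k' : ℕ} (X : Fin k → ℝ) (Y : Fin k' → ℝ) (S : Finset (Fin k × Fin k')) : Prop :=
  Set.InjOn Prod.fst (S : Set (Fin k × Fin k')) ∧ Set.InjOn Prod.snd (S : Set (Fin k × Fin k')) ∧
    ∀ p ∈ S, |X p.1 - Y p.2| < r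

lemma mm_bdd (r : ℝ) {k k' : ℕ} (X : Fin k → ℝ) (Y : Fin k' → ℝ) :
    BddAbove {j : ℕ | ∃ σ : Fin j → Fin k, ∃ τ : Fin j → Fin k',
    Function.Injective σ ∧ Function.Injective τ ∧ ∀ i, |X (σ i) - Y (τ i)| < r} := by
  refine ⟨k, ?_⟩
  rintro j ⟨σ, τ, hσ, hτ, h⟩
  simpa using Fintype.card_le_of_injective σ hσ

lemma PM.card_le {r : ℝ} {k k' : ℕ} {X : Fin k → ℝ} {Y : Fin k' → ℝ}
    {S : Finset (Fin k × Fin k')} (h : PM r X Y S) : S.card ≤ mmSize r X Y := by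
  refine le_csSup (mm_bdd r X Y) ?_
  let e := S.equivFin.symm
  refine ⟨fun i => (e i).1.1, fun i => (e i).1.2, ?_, ?_, ?_⟩
  · intro i j hij
    exact e.injective (Subtype.ext (h.1 (e i).2 (e j).2 hij))
  · intro i j hij
    exact e.injective (Subtype.ext (h.2.1 (e i).2 (e j).2 hij))
  · intro i
    exact h.2.2 _ (e i).2

lemma exists_PM (r : ℝ) {k k' : ℕ} (X : Fin k → ℝ) (Y : Fin k' → ℝ) :
    ∃ S, PM r X Y S ∧ S.card = mmSize r X Y := by
  have hm := Nat.sSup_mem (s := {j : ℕ | ∃ σ : Fin j → Fin k, ∃ τ : Fin j → Fin k',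
    Function.Injective σ ∧ Function.Injective τ ∧ ∀ i, |X (σ i) - Y (τ i)| < r})
    ⟨0, fun i => i.elim0, fun i => i.elim0, fun i => i.elim0, fun i => i.elim0, fun i => i.elim0⟩
    (mm_bdd r X Y)
  change ∃ σ : Fin (mmSize r X Y) → Fin k, ∃ τ : Fin (mmSize r X Y) → Fin k', _ at hm
  obtain ⟨σ, τ, hσ, hτ, h⟩ := hm
  refine ⟨Finset.univ.image fun i => (σ i, τ i), ⟨?_, ?_, ?_⟩, ?_⟩
  · intro p hp q hq hpq
    simp only [Finset.coe_image, Finset.coe_univ, Set.image_univ, Set.mem_range] at hp hq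
    obtain ⟨i, rfl⟩ := hp
    obtain ⟨j, rfl⟩ := hq
    rw [hσ hpq]
  · intro p hp q hq hpq
    simp only [Finset.coe_image, Finset.coe_univ, Set.image_univ, Set.mem_range] at hp hq
    obtain ⟨i, rfl⟩ := hp
    obtain ⟨j, rfl⟩ := hq
    rw [hτ hpq]
  · intro p hp
    simp only [Finset.mem_image, Finset.mem_univ, true_and] at hp
    obtain ⟨i, rfl⟩ := hp
    exact h i
  · rw [Finset.card_image_of_injective]
    · simp
    · intro i j hij
      exact hσ (Prod.mk.inj hij).1

lemma mm_swap_le (r : ℝ) {k k' : ℕ} (X : Fin k → ℝ) (Y : Fin k' → ℝ) :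
    mmSize r X Y ≤ mmSize r Y X := by
  obtain ⟨S, hS, hc⟩ := exists_PM r X Y
  rw [← hc, ← Finset.card_map (Equiv.prodComm _ _).toEmbedding]
  refine PM.card_le ⟨?_, ?_, ?_⟩
  · rintro ⟨p1, p2⟩ hp ⟨q1, q2⟩ hq hpq
    simp at hp hq
    have := hS.2.1 hp hq hpq
    simpa [Prod.ext_iff, and_comm] using this
  · rintro ⟨p1, p2⟩ hp ⟨q1, q2⟩ hq hpq
    simp at hp hq
    have := hS.1 hp hq hpq
    simpa [Prod.ext_iff, and_comm] using this
  · rintro ⟨p1, p2⟩ hp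
    simp at hp
    rw [abs_sub_comm]
    exact hS.2.2 _ hp

lemma mm_swap (r : ℝ) {k k' : ℕ} (X : Fin k → ℝ) (Y : Fin k' → ℝ) :
    mmSize r X Y = mmSize r Y X := le_antisymm (mm_swap_le r X Y) (mm_swap_le r Y X)

/-- Transfer of matchings along an injection of the first index set, on a subset of it. -/
lemma mm_le_of_inj (r : ℝ) {k l k' : ℕ} {X : Fin k → ℝ} {X' : Fin l → ℝ} (Y : Fin k' → ℝ)
    (e : Fin k → Fin l) (he : Function.Injective e) (hX : ∀ i, X' (e i) = X i) :
    mmSize r X Y ≤ mmSize r X' Y := by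
  obtain ⟨S, hS, hc⟩ := exists_PM r X Y
  rw [← hc, ← Finset.card_image_of_injective S
    (f := Prod.map e id) (he.prodMap Function.injective_id)]
  refine PM.card_le ⟨?_, ?_, ?_⟩
  · intro p hp q hq hpq
    simp only [Finset.coe_image, Set.mem_image, SetLike.mem_coe] at hp hq
    obtain ⟨p', hp', rfl⟩ := hp
    obtain ⟨q', hq', rfl⟩ := hq
    rw [hS.1 hp' hq' (he hpq)]
  · intro p hp q hq hpq
    simp only [Finset.coe_image, Set.mem_image, SetLike.mem_coe] at hp hq
    obtain ⟨p', hp', rfl⟩ := hp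
    obtain ⟨q', hq', rfl⟩ := hq
    rw [hS.2.1 hp' hq' hpq]
  · intro p hp
    simp only [Finset.mem_image] at hp
    obtain ⟨p', hp', rfl⟩ := hp
    simpa [hX] using hS.2.2 _ hp'

lemma mm_perm (r : ℝ) {k k' : ℕ} (X : Fin k → ℝ) (Y : Fin k' → ℝ) (e : Equiv.Perm (Fin k)) :
    mmSize r (X ∘ e) Y = mmSize r X Y :=
  le_antisymm (mm_le_of_inj r Y e e.injective fun _ => rfl)
    (mm_le_of_inj r Y e.symm e.symm.injective fun _ => by simp)

lemma mm_perm_right (r : ℝ) {k k' : ℕ} (X : Fin k → ℝ) (Y : Fin k' → ℝ) (e : Equiv.Perm (Fin k')) :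
    mmSize r X (Y ∘ e) = mmSize r X Y := by
  rw [mm_swap, mm_perm, mm_swap]

lemma mm_le_cons (r : ℝ) {k k' : ℕ} (x : ℝ) (X : Fin k → ℝ) (Y : Fin k' → ℝ) :
    mmSize r X Y ≤ mmSize r (Fin.cons x X : Fin (k + 1) → ℝ) Y :=
  mm_le_of_inj r Y Fin.succ (Fin.succ_injective _) fun _ => by simp

/-- Pull back a matching that avoids the first index. -/
lemma card_le_of_avoid {r : ℝ} {k k' : ℕ} {x : ℝ} {X : Fin k → ℝ} {Y : Fin k' → ℝ}
    {S : Finset (Fin (k + 1) × Fin k')} (hS : PM r (Fin.cons x X : Fin (k + 1) → ℝ) Y S)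
    (h0 : ∀ p ∈ S, p.1 ≠ 0) : S.card ≤ mmSize r X Y := by
  rcases Nat.eq_zero_or_pos k with hk | hk
  · subst hk
    have : S = ∅ := by
      refine Finset.eq_empty_of_forall_notMem fun p hp => h0 p hp (Fin.eq_zero p.1)
    simp [this]
  · let pr : Fin (k + 1) × Fin k' → Fin k × Fin k' := fun p =>
      (if h : p.1 = 0 then ⟨0, hk⟩ else p.1.pred h, p.2)
    have hpr : ∀ p ∈ S, (pr p).1.succ = p.1 := fun p hp => by simp [pr, h0 p hp]
    have hinj : Set.InjOn pr S := by
      intro p hp q hq hpq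
      apply hS.1 hp hq
      change p.1 = q.1
      rw [← hpr p hp, ← hpr q hq, hpq]
    rw [← Finset.card_image_of_injOn hinj]
    refine PM.card_le ⟨?_, ?_, ?_⟩
    · intro p hp q hq hpq
      simp only [Finset.coe_image, Set.mem_image, SetLike.mem_coe] at hp hq
      obtain ⟨p', hp', rfl⟩ := hp
      obtain ⟨q', hq', rfl⟩ := hq
      have : p' = q' := hS.1 hp' hq' (by
        change p'.1 = q'.1
        rw [← hpr p' hp', ← hpr q' hq', hpq])
      rw [this]
    · intro p hp q hq hpq
      simp only [Finset.coe_image, Set.mem_image, SetLike.mem_coe] at hp hq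
      obtain ⟨p', hp', rfl⟩ := hp
      obtain ⟨q', hq', rfl⟩ := hq
      rw [hS.2.1 hp' hq' hpq]
    · intro p hp
      simp only [Finset.mem_image] at hp
      obtain ⟨p', hp', rfl⟩ := hp
      have h1 := hS.2.2 _ hp'
      rw [← hpr p' hp', Fin.cons_succ] at h1
      exact h1

lemma PM.mono {r : ℝ} {k k' : ℕ} {X : Fin k → ℝ} {Y : Fin k' → ℝ}
    {S S' : Finset (Fin k × Fin k')} (h : PM r X Y S) (hS : S' ⊆ S) : PM r X Y S' :=
  ⟨h.1.mono (by exact_mod_cast hS), h.2.1.mono (by exact_mod_cast hS), fun p hp => h.2.2 p (hS hp)⟩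

lemma PM.card_filter {r : ℝ} {k k' : ℕ} {X : Fin k → ℝ} {Y : Fin k' → ℝ}
    {S : Finset (Fin k × Fin k')} (h : PM r X Y S) (i : Fin k) :
    S.card ≤ (S.filter fun p => p.1 ≠ i).card + 1 := by
  have h1 : (S.filter fun p => ¬ p.1 ≠ i).card ≤ 1 := by
    rw [Finset.card_le_one]
    intro a ha b hb
    simp only [ne_eq, not_not, Finset.mem_filter] at ha hb
    exact h.1 ha.1 hb.1 (ha.2.trans hb.2.symm)
  have := Finset.card_filter_add_card_filter_not (s := S) (fun p => p.1 ≠ i)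
  omega

lemma mm_cons_le (r : ℝ) {k k' : ℕ} (x : ℝ) (X : Fin k → ℝ) (Y : Fin k' → ℝ) :
    mmSize r (Fin.cons x X : Fin (k + 1) → ℝ) Y ≤ mmSize r X Y + 1 := by
  obtain ⟨S, hS, hc⟩ := exists_PM r (Fin.cons x X : Fin (k + 1) → ℝ) Y
  have h1 := hS.card_filter 0
  have h2 := card_le_of_avoid (hS.mono (Finset.filter_subset (fun p => p.1 ≠ 0) S))
    (fun p hp => (Finset.mem_filter.1 hp).2)
  omega

lemma mm_update_le (r : ℝ) {k k' : ℕ} (X : Fin k → ℝ) (Y : Fin k' → ℝ) (i : Fin k) (z : ℝ) :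
    mmSize r X Y ≤ mmSize r (Function.update X i z) Y + 1 := by
  obtain ⟨S, hS, hc⟩ := exists_PM r X Y
  have h1 := hS.card_filter i
  have h3 := hS.mono (Finset.filter_subset (fun p => p.1 ≠ i) S)
  have h2 : PM r (Function.update X i z) Y (S.filter fun p => p.1 ≠ i) := by
    refine ⟨h3.1, h3.2.1, fun p hp => ?_⟩
    rw [Function.update_of_ne (Finset.mem_filter.1 hp).2]
    exact h3.2.2 p hp
  have := h2.card_le
  omega

lemma mm_update_abs (r : ℝ) {k k' : ℕ} (X : Fin k → ℝ) (Y : Fin k' → ℝ) (i : Fin k) (z : ℝ) :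
    |(mmSize r X Y : ℝ) - mmSize r (Function.update X i z) Y| ≤ 1 := by
  have h1 := mm_update_le r X Y i z
  have h2 := mm_update_le r (Function.update X i z) Y i (X i)
  simp only [Function.update_idem, Function.update_eq_self] at h2
  rw [abs_le]
  constructor
  · have : (mmSize r (Function.update X i z) Y : ℝ) ≤ mmSize r X Y + 1 := by exact_mod_cast h2
    linarith
  · have : (mmSize r X Y : ℝ) ≤ mmSize r (Function.update X i z) Y + 1 := by exact_mod_cast h1
    linarith

lemma mm_cons_isolated (r : ℝ) {k k' : ℕ} (x : ℝ) (X : Fin k → ℝ) (Y : Fin k' → ℝ)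
    (h : ∀ j, r ≤ |x - Y j|) :
    mmSize r (Fin.cons x X : Fin (k + 1) → ℝ) Y = mmSize r X Y := by
  refine le_antisymm ?_ (mm_le_cons r x X Y)
  obtain ⟨S, hS, hc⟩ := exists_PM r (Fin.cons x X : Fin (k + 1) → ℝ) Y
  rw [← hc]
  refine card_le_of_avoid hS fun p hp h0 => ?_
  have := hS.2.2 p hp
  rw [h0, Fin.cons_zero] at this
  exact absurd this (not_lt.2 (h _))

lemma mm_le_left (r : ℝ) {k k' : ℕ} (X : Fin k → ℝ) (Y : Fin k' → ℝ) : mmSize r X Y ≤ k := by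
  obtain ⟨S, hS, hc⟩ := exists_PM r X Y
  rw [← hc, ← Finset.card_image_of_injOn hS.1]
  simpa using Finset.card_le_univ (S.image Prod.fst)

lemma mm_le_right (r : ℝ) {k k' : ℕ} (X : Fin k → ℝ) (Y : Fin k' → ℝ) : mmSize r X Y ≤ k' := by
  rw [mm_swap]; exact mm_le_left r Y X

/-- Pull back a matching that avoids both first indices. -/
lemma card_le_of_avoid2 {r : ℝ} {k k' : ℕ} {x y : ℝ} {X : Fin k → ℝ} {Y : Fin k' → ℝ}
    {S : Finset (Fin (k + 1) × Fin (k' + 1))}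
    (hS : PM r (Fin.cons x X : Fin (k + 1) → ℝ) (Fin.cons y Y : Fin (k' + 1) → ℝ) S)
    (h0 : ∀ p ∈ S, p.1 ≠ 0) (h0' : ∀ p ∈ S, p.2 ≠ 0) : S.card ≤ mmSize r X Y := by
  classical
  let S' := (Finset.univ : Finset (Fin k × Fin k')).filter fun p => (p.1.succ, p.2.succ) ∈ S
  have hS' : PM r X Y S' := by
    refine ⟨?_, ?_, ?_⟩
    · intro p hp q hq hpq
      simp only [S', Finset.coe_filter, Set.mem_ofPred_eq, Finset.mem_univ, true_and] at hp hq
      have := hS.1 hp hq (by simpa using hpq)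
      simpa [Prod.ext_iff] using this
    · intro p hp q hq hpq
      simp only [S', Finset.coe_filter, Set.mem_ofPred_eq, Finset.mem_univ, true_and] at hp hq
      have := hS.2.1 hp hq (by simpa using hpq)
      simpa [Prod.ext_iff] using this
    · intro p hp
      simp only [S', Finset.mem_filter, Finset.mem_univ, true_and] at hp
      simpa using hS.2.2 _ hp
  refine le_trans ?_ hS'.card_le
  have : S = S'.image fun p => (p.1.succ, p.2.succ) := by
    ext ⟨p1, p2⟩
    simp only [S', Finset.mem_image, Finset.mem_filter, Finset.mem_univ, true_and]
    constructor
    · intro hp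
      have h1 : p1 ≠ 0 := h0 _ hp
      have h2 : p2 ≠ 0 := h0' _ hp
      exact ⟨(p1.pred h1, p2.pred h2), by simpa using hp, by simp⟩
    · rintro ⟨q, hq, h⟩
      rwa [← h]
  rw [this]
  exact Finset.card_image_le

/-- The greedy step: two leftmost points at distance less than `r` may be matched. -/
lemma mm_greedy (r : ℝ) {k k' : ℕ} (x y : ℝ) (X : Fin k → ℝ) (Y : Fin k' → ℝ)
    (hx : ∀ i, x ≤ X i) (hy : ∀ i, y ≤ Y i) (hxy : |x - y| < r) :
    mmSize r (Fin.cons x X : Fin (k + 1) → ℝ) (Fin.cons y Y : Fin (k' + 1) → ℝ)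
      = 1 + mmSize r X Y := by
  classical
  apply le_antisymm
  · obtain ⟨S, hS, hc⟩ := exists_PM r (Fin.cons x X : Fin (k + 1) → ℝ)
      (Fin.cons y Y : Fin (k' + 1) → ℝ)
    rw [← hc]
    by_cases h1 : ∃ j, ((0 : Fin (k + 1)), j) ∈ S
    swap
    · have ha : S.card ≤ mmSize r X (Fin.cons y Y : Fin (k' + 1) → ℝ) :=
        card_le_of_avoid hS fun p hp h0 => h1 ⟨p.2, by rw [← h0]; exact hp⟩
      have hb := mm_cons_le r y Y X
      rw [mm_swap r _ X, mm_swap r Y X] at hb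
      omega
    by_cases h2 : ∃ i, (i, (0 : Fin (k' + 1))) ∈ S
    swap
    · have h3 := hS.mono (Finset.filter_subset (fun p => p.1 ≠ 0) S)
      have h4 := card_le_of_avoid2 h3 (fun p hp => (Finset.mem_filter.1 hp).2)
        (fun p hp h0 => h2 ⟨p.1, by rw [← h0]; exact (Finset.mem_filter.1 hp).1⟩)
      have := hS.card_filter 0
      omega
    obtain ⟨j, hj⟩ := h1
    obtain ⟨i, hi⟩ := h2
    by_cases hj0 : j = 0
    · subst hj0
      have h3 := hS.mono (Finset.filter_subset (fun p => p.1 ≠ 0) S)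
      have h4 := card_le_of_avoid2 h3 (fun p hp => (Finset.mem_filter.1 hp).2)
        (fun p hp h0 => by
          have := Finset.mem_filter.1 hp
          exact this.2 (congrArg Prod.fst (hS.2.1 this.1 hj h0)))
      have := hS.card_filter 0
      omega
    have hi0 : i ≠ 0 := by
      intro h; subst h
      exact hj0 (congrArg Prod.snd (hS.1 hj hi rfl))
    set S1 := S.filter fun p => p.1 ≠ 0 ∧ p.2 ≠ 0 with hS1
    have hnot : (i, j) ∉ S := fun h => hj0 (congrArg Prod.snd (hS.1 h hi rfl))
    have hcard : S.card = S1.card + 2 := by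
      have e : S = insert ((0 : Fin (k+1)), j) (insert (i, (0 : Fin (k'+1))) S1) := by
        ext p
        simp only [Finset.mem_insert, hS1, Finset.mem_filter]
        constructor
        · intro hp
          by_cases ha : p.1 = 0
          · exact Or.inl (hS.1 hp hj ha)
          by_cases hb : p.2 = 0
          · exact Or.inr (Or.inl (hS.2.1 hp hi hb))
          exact Or.inr (Or.inr ⟨hp, ha, hb⟩)
        · rintro (rfl | rfl | h)
          · exact hj
          · exact hi
          · exact h.1
      have h5 : (i, (0 : Fin (k'+1))) ∉ S1 := by simp [hS1]
      have h6 : ((0 : Fin (k+1)), j) ∉ insert (i, (0 : Fin (k'+1))) S1 := by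
        simp [hS1, Ne.symm hi0]
      conv_lhs => rw [e]
      rw [Finset.card_insert_of_notMem h6, Finset.card_insert_of_notMem h5]
    have hS1n : (i, j) ∉ S1 := fun h => hnot (Finset.mem_filter.1 h).1
    have hPM : PM r (Fin.cons x X : Fin (k + 1) → ℝ) (Fin.cons y Y : Fin (k' + 1) → ℝ)
        (insert (i, j) S1) := by
      have h3 : PM r _ _ S1 := hS.mono (Finset.filter_subset _ S)
      refine ⟨?_, ?_, ?_⟩
      · rw [Finset.coe_insert, Set.injOn_insert (by exact_mod_cast hS1n)]
        refine ⟨h3.1, ?_⟩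
        rintro ⟨q, hq, hqi⟩
        have hq' := Finset.mem_filter.1 (Finset.mem_coe.1 hq)
        have := hS.1 hq'.1 hi hqi
        exact hq'.2.2 (congrArg Prod.snd this)
      · rw [Finset.coe_insert, Set.injOn_insert (by exact_mod_cast hS1n)]
        refine ⟨h3.2.1, ?_⟩
        rintro ⟨q, hq, hqi⟩
        have hq' := Finset.mem_filter.1 (Finset.mem_coe.1 hq)
        have := hS.2.1 hq'.1 hj hqi
        exact hq'.2.1 (congrArg Prod.fst this)
      · intro p hp
        rcases Finset.mem_insert.1 hp with rfl | hp
        · have a1 := hS.2.2 _ hj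
          have a2 := hS.2.2 _ hi
          obtain ⟨i', rfl⟩ := Fin.exists_succ_eq.2 hi0
          obtain ⟨j', rfl⟩ := Fin.exists_succ_eq.2 hj0
          simp only [Fin.cons_zero, Fin.cons_succ] at a1 a2 ⊢
          have := hx i'
          have := hy j'
          rw [abs_lt] at a1 a2 ⊢
          constructor <;> linarith
        · exact h3.2.2 p hp
    have := card_le_of_avoid2 hPM
      (fun p hp => by
        rcases Finset.mem_insert.1 hp with rfl | hp
        · exact hi0
        · exact (Finset.mem_filter.1 hp).2.1)
      (fun p hp => by
        rcases Finset.mem_insert.1 hp with rfl | hp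
        · exact hj0
        · exact (Finset.mem_filter.1 hp).2.2)
    rw [Finset.card_insert_of_notMem hS1n] at this
    omega
  · obtain ⟨S, hS, hc⟩ := exists_PM r X Y
    set S1 := S.image fun p => (p.1.succ, p.2.succ) with hS1
    have hc1 : S1.card = S.card := Finset.card_image_of_injective _ (by
      rintro ⟨a, b⟩ ⟨a', b'⟩ h
      simpa using h)
    have hn : ((0 : Fin (k+1)), (0 : Fin (k'+1))) ∉ S1 := by
      simp [hS1]
    have hPM : PM r (Fin.cons x X : Fin (k + 1) → ℝ) (Fin.cons y Y : Fin (k' + 1) → ℝ)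
        (insert (0, 0) S1) := by
      refine ⟨?_, ?_, ?_⟩
      · rw [Finset.coe_insert, Set.injOn_insert (by exact_mod_cast hn)]
        constructor
        · intro p hp q hq hpq
          simp only [hS1, Finset.coe_image, Set.mem_image, SetLike.mem_coe] at hp hq
          obtain ⟨p', hp', rfl⟩ := hp
          obtain ⟨q', hq', rfl⟩ := hq
          rw [hS.1 hp' hq' (by simpa using hpq)]
        · rintro ⟨q, hq, hqi⟩
          simp only [hS1, Finset.coe_image, Set.mem_image, SetLike.mem_coe] at hq
          obtain ⟨q', hq', rfl⟩ := hq
          simp at hqi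
      · rw [Finset.coe_insert, Set.injOn_insert (by exact_mod_cast hn)]
        constructor
        · intro p hp q hq hpq
          simp only [hS1, Finset.coe_image, Set.mem_image, SetLike.mem_coe] at hp hq
          obtain ⟨p', hp', rfl⟩ := hp
          obtain ⟨q', hq', rfl⟩ := hq
          rw [hS.2.1 hp' hq' (by simpa using hpq)]
        · rintro ⟨q, hq, hqi⟩
          simp only [hS1, Finset.coe_image, Set.mem_image, SetLike.mem_coe] at hq
          obtain ⟨q', hq', rfl⟩ := hq
          simp at hqi
      · intro p hp
        rcases Finset.mem_insert.1 hp with rfl | hp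
        · simpa using hxy
        · simp only [hS1, Finset.mem_image] at hp
          obtain ⟨p', hp', rfl⟩ := hp
          simpa using hS.2.2 _ hp'
    have := hPM.card_le
    rw [Finset.card_insert_of_notMem hn, hc1, hc] at this
    omega

lemma measurable_mm (r : ℝ) (k k' : ℕ) :
    Measurable fun p : (Fin k → ℝ) × (Fin k' → ℝ) => mmSize r p.1 p.2 := by
  have key : ∀ n, {p : (Fin k → ℝ) × (Fin k' → ℝ) | n ≤ mmSize r p.1 p.2}
      = ⋃ S : Finset (Fin k × Fin k'), {p | n ≤ S.card ∧ PM r p.1 p.2 S} := by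
    intro n
    ext p
    simp only [Set.mem_ofPred_eq, Set.mem_iUnion]
    constructor
    · intro h
      obtain ⟨S, hS, hc⟩ := exists_PM r p.1 p.2
      exact ⟨S, by omega, hS⟩
    · rintro ⟨S, hn, hS⟩
      exact hn.trans hS.card_le
  refine measurable_of_Ici fun n => ?_
  change MeasurableSet {p : (Fin k → ℝ) × (Fin k' → ℝ) | n ≤ mmSize r p.1 p.2}
  rw [key]
  refine MeasurableSet.iUnion fun S => ?_
  unfold PM
  refine (MeasurableSet.const _).inter ((MeasurableSet.const _).inter
    ((MeasurableSet.const _).inter ?_))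
  have : {a : (Fin k → ℝ) × (Fin k' → ℝ) | ∀ p ∈ S, |a.1 p.1 - a.2 p.2| < r}
      = ⋂ p ∈ S, {a | |a.1 p.1 - a.2 p.2| < r} := by
    ext; simp
  change MeasurableSet {a : (Fin k → ℝ) × (Fin k' → ℝ) | ∀ p ∈ S, |a.1 p.1 - a.2 p.2| < r}
  rw [this]
  refine Finset.measurableSet_biInter S fun p _ => ?_
  exact measurableSet_lt (by fun_prop) measurable_const

open ProbabilityTheory in
lemma sg_prod {α β : Type*} [MeasurableSpace α] [MeasurableSpace β] (μ : Measure α) (ν : Measure β)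
    [IsProbabilityMeasure μ] [IsProbabilityMeasure ν] (F : α × β → ℝ) (hF : Measurable F)
    (B : ℝ) (hB : ∀ p, |F p| ≤ B) (c1 c2 : NNReal)
    (h1 : ∀ b, HasSubgaussianMGF (fun a => F (a, b) - ∫ a', F (a', b) ∂μ) c1 μ)
    (h2 : HasSubgaussianMGF (fun b => (∫ a', F (a', b) ∂μ) - ∫ p, F p ∂(μ.prod ν)) c2 ν) :
    HasSubgaussianMGF (fun p => F p - ∫ p, F p ∂(μ.prod ν)) (c1 + c2) (μ.prod ν) := by
  set m := ∫ p, F p ∂(μ.prod ν) with hm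
  have hIntg : ∀ t, Integrable (fun p => Real.exp (t * (F p - m))) (μ.prod ν) := by
    intro t
    refine Integrable.of_bound (C := Real.exp (|t| * (B + |m|))) (by fun_prop) ?_
    refine Filter.Eventually.of_forall fun p => ?_
    rw [Real.norm_eq_abs, abs_of_pos (Real.exp_pos _)]
    apply Real.exp_le_exp.2
    calc t * (F p - m) ≤ |t * (F p - m)| := le_abs_self _
      _ = |t| * |F p - m| := abs_mul _ _
      _ ≤ |t| * (B + |m|) := by
        gcongr
        exact (abs_sub _ _).trans (by linarith [hB p])
  refine ⟨hIntg, fun t => ?_⟩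
  unfold mgf
  rw [integral_prod_symm _ (hIntg t)]
  have hle : ∀ b, ∫ a, Real.exp (t * (F (a, b) - m)) ∂μ
      ≤ Real.exp (c1 * t ^ 2 / 2) * Real.exp (t * ((∫ a', F (a', b) ∂μ) - m)) := by
    intro b
    have := (h1 b).mgf_le t
    unfold mgf at this
    have e : ∀ a, Real.exp (t * (F (a, b) - m))
        = Real.exp (t * (F (a, b) - ∫ a', F (a', b) ∂μ)) * Real.exp (t * ((∫ a', F (a', b) ∂μ) - m)) := by
      intro a
      rw [← Real.exp_add]; congr 1; ring
    simp_rw [e]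
    rw [integral_mul_const]
    gcongr
  calc ∫ b, ∫ a, Real.exp (t * (F (a, b) - m)) ∂μ ∂ν
      ≤ ∫ b, Real.exp (c1 * t ^ 2 / 2) * Real.exp (t * ((∫ a', F (a', b) ∂μ) - m)) ∂ν :=
        integral_mono (hIntg t).integral_prod_right ((h2.integrable_exp_mul t).const_mul _) hle
    _ = Real.exp (c1 * t ^ 2 / 2) * ∫ b, Real.exp (t * ((∫ a', F (a', b) ∂μ) - m)) ∂ν :=
        integral_const_mul _ _
    _ ≤ Real.exp (c1 * t ^ 2 / 2) * Real.exp (c2 * t ^ 2 / 2) := by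
        gcongr
        exact h2.mgf_le t
    _ = Real.exp (((c1 + c2 : NNReal) : ℝ) * t ^ 2 / 2) := by
        rw [← Real.exp_add]; congr 1; push_cast; ring

lemma bdd_integrable {α : Type*} [MeasurableSpace α] (μ : Measure α) [IsFiniteMeasure μ]
    {F : α → ℝ} (hF : Measurable F) {B : ℝ} (hB : ∀ p, |F p| ≤ B) : Integrable F μ :=
  Integrable.of_bound (C := B) hF.aestronglyMeasurable (Filter.Eventually.of_forall hB)

lemma bdd_integral {α : Type*} [MeasurableSpace α] (μ : Measure α) [IsProbabilityMeasure μ]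
    {F : α → ℝ} {B : ℝ} (hB : ∀ p, |F p| ≤ B) : |∫ a, F a ∂μ| ≤ B := by
  have := norm_integral_le_of_norm_le_const (μ := μ) (f := F) (C := B)
    (Filter.Eventually.of_forall hB)
  simpa using this

lemma piFin_symm_cons {n : ℕ} (p : ℝ × (Fin n → ℝ)) :
    (MeasurableEquiv.piFinSuccAbove (fun _ : Fin (n+1) => ℝ) 0).symm p
      = (Fin.cons p.1 p.2 : Fin (n+1) → ℝ) := by
  simp [MeasurableEquiv.piFinSuccAbove_symm_apply, Fin.insertNthEquiv, Fin.insertNth_zero]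

lemma measurable_cons {n : ℕ} :
    Measurable fun p : ℝ × (Fin n → ℝ) => (Fin.cons p.1 p.2 : Fin (n+1) → ℝ) := by
  have := (MeasurableEquiv.piFinSuccAbove (fun _ : Fin (n+1) => ℝ) 0).symm.measurable
  have e : ⇑(MeasurableEquiv.piFinSuccAbove (fun _ : Fin (n+1) => ℝ) 0).symm
      = fun p : ℝ × (Fin n → ℝ) => (Fin.cons p.1 p.2 : Fin (n+1) → ℝ) :=
    funext piFin_symm_cons
  rwa [e] at this

open ProbabilityTheory in
/-- A McDiarmid-type inequality. -/
lemma mcdiarmid (μ : Measure ℝ) [IsProbabilityMeasure μ] : ∀ (n : ℕ) (f : (Fin n → ℝ) → ℝ),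
    Measurable f → ∀ B : ℝ, (∀ x, |f x| ≤ B) →
    (∀ x i z, |f x - f (Function.update x i z)| ≤ 1) →
    HasSubgaussianMGF (fun x => f x - ∫ x, f x ∂(Measure.pi fun _ : Fin n => μ)) (n : NNReal)
      (Measure.pi fun _ : Fin n => μ) := by
  intro n
  induction n with
  | zero =>
    intro f hf B hB hd
    have : (fun x => f x - ∫ x, f x ∂(Measure.pi fun _ : Fin 0 => μ)) = fun _ => 0 := by
      funext x
      have : ∀ y, f y = f x := fun y => by rw [Subsingleton.elim y x]
      simp [this]
    rw [this]
    simp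
  | succ n ih =>
    intro f hf B hB hd
    set π := Measure.pi fun _ : Fin n => μ
    have hmp := measurePreserving_piFinSuccAbove (fun _ : Fin (n+1) => μ) 0
    set e := MeasurableEquiv.piFinSuccAbove (fun _ : Fin (n+1) => ℝ) 0 with he
    have hcons : Measurable fun p : ℝ × (Fin n → ℝ) => (Fin.cons p.1 p.2 : Fin (n+1) → ℝ) := measurable_cons
    set F : ℝ × (Fin n → ℝ) → ℝ := fun p => f (Fin.cons p.1 p.2 : Fin (n+1) → ℝ) with hFd
    have hF : Measurable F := hf.comp hcons
    have hFe : ∀ x, F (e x) = f x := by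
      intro x
      simp only [hFd]
      rw [← piFin_symm_cons, ← he, e.symm_apply_apply]
    have hB' : ∀ p, |F p| ≤ B := fun p => hB _
    have hIntg : ∫ x, f x ∂(Measure.pi fun _ : Fin (n+1) => μ) = ∫ p, F p ∂(μ.prod π) := by
      rw [← hmp.integral_comp' (f := e) F]
      simp only [hFe]
    have hprod : HasSubgaussianMGF (fun p => F p - ∫ p, F p ∂(μ.prod π)) (1 + (n : NNReal))
        (μ.prod π) := by
      refine sg_prod μ π F hF B hB' 1 n ?_ ?_
      · intro b
        have := hasSubgaussianMGF_of_mem_Icc (μ := μ) (X := fun a => F (a, b)) (a := F (0, b) - 1)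
          (b := F (0, b) + 1) (by fun_prop) (Filter.Eventually.of_forall fun a => by
            have h := hd (Fin.cons a b) 0 0
            rw [Fin.update_cons_zero, abs_le] at h
            simp only [hFd, Set.mem_Icc]
            constructor <;> linarith)
        convert this using 1
        rw [← NNReal.coe_inj]
        norm_num
      · rw [integral_prod_symm _ (bdd_integrable _ hF hB')]
        refine ih (fun b => ∫ a, F (a, b) ∂μ) ?_ B ?_ ?_
        · exact (hF.stronglyMeasurable.integral_prod_left').measurable
        · intro b
          exact bdd_integral μ fun a => hB' _
        · intro b i z
          rw [← integral_sub (bdd_integrable _ (by fun_prop) fun a => hB' _)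
            (bdd_integrable _ (by fun_prop) fun a => hB' _)]
          refine bdd_integral μ fun a => ?_
          have h := hd (Fin.cons a b) i.succ z
          rw [← Fin.cons_update] at h
          exact h
    have := HasSubgaussianMGF.of_map (μ := Measure.pi fun _ : Fin (n+1) => μ) (Y := e)
      (X := fun p => F p - ∫ p, F p ∂(μ.prod π)) e.measurable.aemeasurable (by rw [hmp.map_eq]; exact hprod)
    rw [hIntg]
    convert this using 1
    · funext x
      simp [hFe]
    · push_cast; ring

instance unif01_prob : IsProbabilityMeasure (volume.restrict (Set.Icc (0 : ℝ) 1)) :=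
  ⟨by simp⟩

instance unifCube_prob (N : ℕ) : IsProbabilityMeasure (unifCube N) := by
  unfold unifCube; infer_instance

open ProbabilityTheory in
lemma mcdiarmid_unif (n : ℕ) (f : (Fin n → ℝ) → ℝ)
    (hf : Measurable f) (B : ℝ) (hB : ∀ x, |f x| ≤ B)
    (hd : ∀ x i z, |f x - f (Function.update x i z)| ≤ 1) :
    HasSubgaussianMGF (fun x => f x - ∫ x, f x ∂(unifCube n)) (n : NNReal) (unifCube n) :=
  mcdiarmid (volume.restrict (Set.Icc (0 : ℝ) 1)) n f hf B hB hd

lemma measurable_mmR (r : ℝ) (k k' : ℕ) :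
    Measurable fun p : (Fin k → ℝ) × (Fin k' → ℝ) => (mmSize r p.1 p.2 : ℝ) :=
  measurable_from_top.comp (measurable_mm r k k')

lemma mm_abs_le (r : ℝ) {k k' : ℕ} (X : Fin k → ℝ) (Y : Fin k' → ℝ) :
    |(mmSize r X Y : ℝ)| ≤ k := by
  rw [abs_of_nonneg (by positivity)]
  exact_mod_cast mm_le_left r X Y

open ProbabilityTheory in
lemma mm_sg (r : ℝ) (N : ℕ) :
    HasSubgaussianMGF (fun p : (Fin N → ℝ) × (Fin N → ℝ) => (mmSize r p.1 p.2 : ℝ)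
      - ∫ p, (mmSize r p.1 p.2 : ℝ) ∂((unifCube N).prod (unifCube N))) (N + N : NNReal)
      ((unifCube N).prod (unifCube N)) := by
  have hm := measurable_mmR r N N
  have hm1 : ∀ b : Fin N → ℝ, Measurable fun a : Fin N → ℝ => (mmSize r a b : ℝ) := fun b =>
    hm.comp (g := fun p : (Fin N → ℝ) × (Fin N → ℝ) => (mmSize r p.1 p.2 : ℝ))
      (f := fun a : Fin N → ℝ => (a, b)) (by fun_prop)
  refine sg_prod (unifCube N) (unifCube N) (fun p => (mmSize r p.1 p.2 : ℝ)) hm N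
    (fun p => mm_abs_le r _ _) N N ?_ ?_
  · intro b
    exact mcdiarmid_unif N (fun a => (mmSize r a b : ℝ)) (hm1 _)
      N (fun x => mm_abs_le r _ _) (fun x i z => mm_update_abs r x b i z)
  · rw [integral_prod_symm _ (bdd_integrable _ hm fun p => mm_abs_le r _ _)]
    refine mcdiarmid_unif N (fun b => ∫ a, (mmSize r a b : ℝ) ∂(unifCube N)) ?_ N ?_ ?_
    · exact (hm.stronglyMeasurable.integral_prod_left').measurable
    · intro b
      exact bdd_integral _ fun a => mm_abs_le r _ _
    · intro b i z
      rw [← integral_sub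
        (bdd_integrable _ (hm1 _) fun a => mm_abs_le r a b)
        (bdd_integrable _ (hm1 _) fun a => mm_abs_le r a _)]
      refine bdd_integral _ fun a => ?_
      rw [mm_swap r a b, mm_swap r a]
      exact mm_update_abs r b a i z

open ProbabilityTheory in
lemma mm_conc (r : ℝ) (N : ℕ) (hN : 0 < N) (t : ℝ) (ht : 0 ≤ t) :
    ((unifCube N).prod (unifCube N)).real {p : (Fin N → ℝ) × (Fin N → ℝ) |
      t ≤ |(mmSize r p.1 p.2 : ℝ)
      - ∫ p, (mmSize r p.1 p.2 : ℝ) ∂((unifCube N).prod (unifCube N))|} ≤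
      2 * Real.exp (- t ^ 2 / (4 * N)) := by
  have h := mm_sg r N
  have h1 := h.measure_ge_le ht
  have h2 := h.neg.measure_ge_le ht
  set m := ∫ p, (mmSize r p.1 p.2 : ℝ) ∂((unifCube N).prod (unifCube N))
  have hsub : {p : (Fin N → ℝ) × (Fin N → ℝ) | t ≤ |(mmSize r p.1 p.2 : ℝ) - m|} ⊆
      {p | t ≤ (mmSize r p.1 p.2 : ℝ) - m} ∪
      {p | t ≤ (-(fun p : (Fin N → ℝ) × (Fin N → ℝ) => (mmSize r p.1 p.2 : ℝ) - m)) p} := by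
    intro p hp
    rcases le_abs.1 (show t ≤ |(mmSize r p.1 p.2 : ℝ) - m| from hp) with h | h
    · exact Or.inl h
    · exact Or.inr h
  have h3 := (measureReal_mono (μ := (unifCube N).prod (unifCube N)) hsub).trans
    (measureReal_union_le _ _)
  have e : (2 : ℝ) * ((N + N : NNReal) : ℝ) = 4 * N := by push_cast; ring
  rw [e] at h1 h2
  linarith

/-- Product of `n` copies of Lebesgue measure on `[s,1]`. -/
noncomputable def nuM (s : ℝ) (n : ℕ) : Measure (Fin n → ℝ) :=
  Measure.pi fun _ => volume.restrict (Set.Icc s 1)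

instance nuM_fin (s : ℝ) (n : ℕ) : IsFiniteMeasure (nuM s n) := by
  unfold nuM; infer_instance

lemma nuM_eq (s : ℝ) (n : ℕ) :
    nuM s n = (volume : Measure (Fin n → ℝ)).restrict (Set.univ.pi fun _ => Set.Icc s 1) := by
  rw [volume_pi, Measure.restrict_pi_pi]; rfl

lemma nuM_restrict {s x : ℝ} (h : s ≤ x) (n : ℕ) :
    (nuM s n).restrict {z | ∀ i, x ≤ z i} = nuM x n := by
  have e : {z : Fin n → ℝ | ∀ i, x ≤ z i} = Set.univ.pi fun _ => Set.Ici x := by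
    ext z; exact ⟨fun h i _ => h i, fun h i => h i trivial⟩
  rw [e]
  unfold nuM
  rw [Measure.restrict_pi_pi]
  congr 1
  funext i
  rw [Measure.restrict_restrict measurableSet_Ici]
  congr 1
  ext y
  simp only [Set.mem_inter_iff, Set.mem_Ici, Set.mem_Icc]
  constructor
  · rintro ⟨a, b, c⟩; exact ⟨a, c⟩
  · rintro ⟨a, c⟩; exact ⟨a, h.trans a, c⟩

lemma measurable_nuM {α : Type*} [MeasurableSpace α] {n : ℕ} {ψ : α × (Fin n → ℝ) → ENNReal}
    (hψ : Measurable ψ) {s : α → ℝ} (hs : Measurable s) :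
    Measurable fun a => ∫⁻ z, ψ (a, z) ∂(nuM (s a) n) := by
  have hms : MeasurableSet {p : α × (Fin n → ℝ) | ∀ i, s p.1 ≤ p.2 i ∧ p.2 i ≤ 1} := by
    have : {p : α × (Fin n → ℝ) | ∀ i, s p.1 ≤ p.2 i ∧ p.2 i ≤ 1} =
        ⋂ i, ({p | s p.1 ≤ p.2 i} ∩ {p | p.2 i ≤ 1}) := by
      ext; simp
    rw [this]
    refine MeasurableSet.iInter fun i => MeasurableSet.inter ?_ ?_
    · exact measurableSet_le (by fun_prop) (by fun_prop)
    · exact measurableSet_le (by fun_prop) (by fun_prop)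
  have := (hψ.indicator hms).lintegral_prod_right' (ν := (volume : Measure (Fin n → ℝ)))
  convert this using 2 with a
  rw [nuM_eq, ← lintegral_indicator (MeasurableSet.univ_pi fun _ => measurableSet_Icc)]
  refine lintegral_congr fun z => ?_
  by_cases h : z ∈ Set.univ.pi fun _ : Fin n => Set.Icc (s a) 1
  · rw [Set.indicator_of_mem h, Set.indicator_of_mem]
    exact fun i => h i trivial
  · rw [Set.indicator_of_notMem h, Set.indicator_of_notMem]
    exact fun h' => h fun i _ => h' i

lemma mp_cons (μ : Measure ℝ) [SigmaFinite μ] (n : ℕ) :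
    MeasurePreserving (fun p : ℝ × (Fin n → ℝ) => (Fin.cons p.1 p.2 : Fin (n+1) → ℝ))
      (μ.prod (Measure.pi fun _ : Fin n => μ)) (Measure.pi fun _ : Fin (n+1) => μ) := by
  have := (measurePreserving_piFinSuccAbove (fun _ : Fin (n+1) => μ) 0).symm
  have e : ⇑(MeasurableEquiv.piFinSuccAbove (fun _ : Fin (n+1) => ℝ) 0).symm
      = fun p : ℝ × (Fin n → ℝ) => (Fin.cons p.1 p.2 : Fin (n+1) → ℝ) :=
    funext piFin_symm_cons
  rwa [e] at this

lemma lintegral_cons (μ : Measure ℝ) [SigmaFinite μ] (n : ℕ) {φ : (Fin (n+1) → ℝ) → ENNReal}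
    (hφ : Measurable φ) :
    ∫⁻ z, φ z ∂(Measure.pi fun _ : Fin (n+1) => μ) =
      ∫⁻ x, ∫⁻ z, φ (Fin.cons x z : Fin (n+1) → ℝ) ∂(Measure.pi fun _ : Fin n => μ) ∂μ := by
  rw [← (mp_cons μ n).lintegral_comp hφ, lintegral_prod]
  exact (hφ.comp measurable_cons).aemeasurable

/-- Decomposition of the integral of a symmetric function according to the smallest coordinate. -/
lemma min_decomp (s : ℝ) (n : ℕ) (φ : (Fin (n+1) → ℝ) → ENNReal) (hφ : Measurable φ)
    (hsym : ∀ (e : Equiv.Perm (Fin (n+1))) z, φ (z ∘ e) = φ z) :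
    ∫⁻ z, φ z ∂(nuM s (n+1)) =
      (n + 1 : ℕ) * ∫⁻ x in Set.Icc s 1, ∫⁻ z, φ (Fin.cons x z : Fin (n+1) → ℝ) ∂(nuM x n) := by
  set A : Fin (n+1) → Set (Fin (n+1) → ℝ) := fun i => {z | ∀ j, z i ≤ z j} with hA
  have hAm : ∀ i, MeasurableSet (A i) := by
    intro i
    have : A i = ⋂ j, {z | z i ≤ z j} := by ext; simp [hA]
    rw [this]
    exact MeasurableSet.iInter fun j => measurableSet_le (by fun_prop) (by fun_prop)
  have hAu : (⋃ i, A i) = Set.univ := by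
    ext z
    simp only [Set.mem_iUnion, Set.mem_univ, iff_true]
    obtain ⟨i, -, hi⟩ := Finset.exists_min_image Finset.univ z ⟨0, Finset.mem_univ _⟩
    exact ⟨i, fun j => hi j (Finset.mem_univ _)⟩
  have hAd : Pairwise (Function.onFun (AEDisjoint (nuM s (n+1))) A) := by
    intro i j hij
    have hsub : A i ∩ A j ⊆ ((LinearMap.ker (LinearMap.proj (R := ℝ) (φ := fun _ : Fin (n+1) => ℝ) i - LinearMap.proj j) : Submodule ℝ (Fin (n+1) → ℝ)) : Set (Fin (n+1) → ℝ)) := by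
      rintro z ⟨h1, h2⟩
      simp only [SetLike.mem_coe, LinearMap.mem_ker, LinearMap.sub_apply, LinearMap.proj_apply]
      have := h1 j
      have := h2 i
      linarith
    refine measure_mono_null hsub ?_
    rw [nuM_eq]
    refine Measure.absolutelyContinuous_of_le Measure.restrict_le_self ?_
    refine Measure.addHaar_submodule _ _ fun htop => ?_
    have : (Pi.single i 1 : Fin (n+1) → ℝ) ∈ LinearMap.ker (LinearMap.proj (R := ℝ) (φ := fun _ : Fin (n+1) => ℝ) i - LinearMap.proj j) := by rw [htop]; trivial
    simp [Ne.symm hij] at this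
  have h1 : ∫⁻ z, φ z ∂(nuM s (n+1)) = ∑ i, ∫⁻ z in A i, φ z ∂(nuM s (n+1)) := by
    rw [← tsum_fintype (L := .unconditional _), ← lintegral_iUnion₀ (fun i => (hAm i).nullMeasurableSet) hAd, hAu,
      Measure.restrict_univ]
  have h2 : ∀ i, ∫⁻ z in A i, φ z ∂(nuM s (n+1)) = ∫⁻ z in A 0, φ z ∂(nuM s (n+1)) := by
    intro i
    have hmp := measurePreserving_arrowCongr' (fun _ : Fin (n+1) => volume.restrict (Set.Icc s 1))
      (fun _ : Fin (n+1) => volume.restrict (Set.Icc s 1)) (Equiv.swap 0 i) (MeasurableEquiv.refl ℝ)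
      (fun _ => MeasurePreserving.id _)
    have key := hmp.setLIntegral_comp_preimage (hAm i) hφ
    unfold nuM
    rw [← key]
    have e : ∀ z : Fin (n+1) → ℝ, (MeasurableEquiv.arrowCongr' (Equiv.swap 0 i) (MeasurableEquiv.refl ℝ)) z
        = z ∘ (Equiv.swap 0 i) := by
      intro z
      funext j
      change z ((Equiv.swap 0 i).symm j) = _
      rw [Equiv.symm_swap]; rfl
    have e2 : (MeasurableEquiv.arrowCongr' (Equiv.swap 0 i) (MeasurableEquiv.refl ℝ)) ⁻¹' (A i) = A 0 := by
      ext z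
      rw [Set.mem_preimage, e]
      simp only [hA, Set.mem_ofPred_eq, Function.comp, Equiv.swap_apply_right]
      constructor
      · intro h j
        simpa using h (Equiv.swap 0 i j)
      · intro h j
        exact h _
    rw [e2]
    refine lintegral_congr fun z => ?_
    rw [e, hsym]
  have h3 : ∫⁻ z in A 0, φ z ∂(nuM s (n+1)) =
      ∫⁻ x in Set.Icc s 1, ∫⁻ z, φ (Fin.cons x z : Fin (n+1) → ℝ) ∂(nuM x n) := by
    rw [← lintegral_indicator (hAm 0)]
    unfold nuM
    rw [lintegral_cons _ n (hφ.indicator (hAm 0))]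
    refine setLIntegral_congr_fun measurableSet_Icc fun x hx => ?_
    change ∫⁻ z, _ ∂(nuM s n) = ∫⁻ z, _ ∂(nuM x n)
    have hms : MeasurableSet {z : Fin n → ℝ | ∀ i, x ≤ z i} := by
      have : {z : Fin n → ℝ | ∀ i, x ≤ z i} = ⋂ j, {z | x ≤ z j} := by ext; simp
      rw [this]
      exact MeasurableSet.iInter fun j => measurableSet_le (by fun_prop) (by fun_prop)
    rw [← nuM_restrict hx.1, ← lintegral_indicator hms]
    refine lintegral_congr fun z => ?_
    by_cases h : ∀ i, x ≤ z i
    · rw [Set.indicator_of_mem, Set.indicator_of_mem]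
      · exact h
      · intro j
        refine Fin.cases ?_ (fun j => ?_) j <;> simp [h]
    · rw [Set.indicator_of_notMem, Set.indicator_of_notMem]
      · exact h
      · intro h'
        exact h fun i => by simpa using h' i.succ
  rw [h1, Finset.sum_congr rfl (fun i _ => h2 i), h3]
  simp

/-- Poisson weights. -/
noncomputable def pw (l s : ℝ) (n : ℕ) : ENNReal :=
  ENNReal.ofReal (l ^ n / n.factorial * Real.exp (-(l * (1 - s))))

/-- Expectation over a Poisson point process of intensity `l` on `[s,1]`. -/
noncomputable def PP (l s : ℝ) (φ : ∀ n, (Fin n → ℝ) → ENNReal) : ENNReal :=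
  ∑' n, pw l s n * ∫⁻ z, φ n z ∂(nuM s n)

/-- Exponential kernel. -/
noncomputable def ker (l d : ℝ) : ENNReal := ENNReal.ofReal (l * Real.exp (-(l * d)))

lemma measurable_ker (l : ℝ) : Measurable (ker l) := by
  unfold ker; fun_prop

lemma ae_nuM (s : ℝ) (n : ℕ) : ∀ᵐ z ∂(nuM s n), ∀ i, s ≤ z i := by
  rw [nuM_eq]
  filter_upwards [ae_restrict_mem (MeasurableSet.univ_pi fun _ => measurableSet_Icc)] with z hz i
  exact (hz i trivial).1

lemma PP_congr {l s : ℝ} {φ ψ : ∀ n, (Fin n → ℝ) → ENNReal}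
    (h : ∀ n z, (∀ i, s ≤ z i) → φ n z = ψ n z) : PP l s φ = PP l s ψ := by
  unfold PP
  refine tsum_congr fun n => ?_
  congr 1
  refine lintegral_congr_ae ?_
  filter_upwards [ae_nuM s n] with z hz using h n z hz

lemma PP_mono {l s : ℝ} {φ ψ : ∀ n, (Fin n → ℝ) → ENNReal}
    (h : ∀ n z, φ n z ≤ ψ n z) : PP l s φ ≤ PP l s ψ := by
  unfold PP
  exact ENNReal.tsum_le_tsum fun n => mul_le_mul_right (lintegral_mono fun z => h n z) _

lemma nuM_univ (s : ℝ) (n : ℕ) : nuM s n Set.univ = ENNReal.ofReal (1 - s) ^ n := by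
  unfold nuM
  rw [Measure.pi_univ]
  simp

lemma PP_pow {l s a : ℝ} (hl : 0 ≤ l) (hs : s ≤ 1) (ha : 0 ≤ a) :
    PP l s (fun n _ => ENNReal.ofReal a ^ n) = ENNReal.ofReal (Real.exp (l * (1 - s) * (a - 1))) := by
  unfold PP
  have h1 : ∀ n, pw l s n * ∫⁻ z, ENNReal.ofReal a ^ n ∂(nuM s n) =
      ENNReal.ofReal (Real.exp (-(l * (1 - s))) * ((l * (1 - s) * a) ^ n / n.factorial)) := by
    intro n
    rw [lintegral_const, nuM_univ, pw, ← ENNReal.ofReal_pow ha, ← ENNReal.ofReal_pow (by linarith),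
      ← ENNReal.ofReal_mul (by positivity), ← ENNReal.ofReal_mul (by positivity)]
    congr 1
    rw [mul_pow, mul_pow]; ring
  simp_rw [h1]
  have h1s : 0 ≤ 1 - s := by linarith
  have hs := (NormedSpace.expSeries_div_hasSum_exp (𝔸 := ℝ) (l * (1 - s) * a))
  rw [← Real.exp_eq_exp_ℝ] at hs
  have hs2 := hs.mul_left (Real.exp (-(l * (1 - s))))
  rw [← ENNReal.ofReal_tsum_of_nonneg (fun n => by positivity) hs2.summable, hs2.tsum_eq,
    ← Real.exp_add]
  congr 2; ring

lemma PP_one {l s : ℝ} (hl : 0 ≤ l) (hs : s ≤ 1) : PP l s (fun _ _ => 1) = 1 := by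
  have := PP_pow hl hs zero_le_one
  simpa using this

lemma PP_mul {l s : ℝ} (b : ENNReal) (hb : b ≠ ⊤) (φ : ∀ n, (Fin n → ℝ) → ENNReal) :
    PP l s (fun n z => b * φ n z) = b * PP l s φ := by
  unfold PP
  rw [← ENNReal.tsum_mul_left]
  refine tsum_congr fun n => ?_
  rw [lintegral_const_mul' _ _ hb]; ring

lemma PP_one_add {l s : ℝ} (hl : 0 ≤ l) (hs : s ≤ 1) (φ : ∀ n, (Fin n → ℝ) → ENNReal) :
    PP l s (fun n z => 1 + φ n z) = 1 + PP l s φ := by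
  have h1 : PP l s (fun n z => 1 + φ n z) = PP l s (fun _ _ => 1) + PP l s φ := by
    unfold PP
    rw [← ENNReal.tsum_add]
    refine tsum_congr fun n => ?_
    rw [lintegral_add_left measurable_const, mul_add]
  rw [h1, PP_one hl hs]

lemma measurable_pw (l : ℝ) (n : ℕ) : Measurable fun s => pw l s n := by
  unfold pw; fun_prop

lemma measurable_PP {α : Type*} [MeasurableSpace α] (l : ℝ) {ψ : ∀ n, α → (Fin n → ℝ) → ENNReal}
    (hψ : ∀ n, Measurable (Function.uncurry (ψ n))) {s : α → ℝ} (hs : Measurable s) :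
    Measurable fun a => PP l (s a) (fun n => ψ n a) := by
  unfold PP
  refine Measurable.tsum fun n => ?_
  refine Measurable.mul ((measurable_pw l n).comp hs) ?_
  exact measurable_nuM (hψ n) hs

lemma PP_swap (l s t : ℝ) {k : ℝ → ENNReal} (hk : Measurable k) (hk' : ∀ y, k y ≠ ⊤)
    {Q : ∀ n, (Fin n → ℝ) → ℝ → ENNReal}
    (hQ : ∀ n, Measurable (Function.uncurry (Q n))) :
    PP l s (fun n z => ∫⁻ y in Set.Icc t 1, k y * Q n z y) =
      ∫⁻ y in Set.Icc t 1, k y * PP l s (fun n z => Q n z y) := by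
  unfold PP
  have h1 : ∀ n, pw l s n * ∫⁻ z, (∫⁻ y in Set.Icc t 1, k y * Q n z y) ∂(nuM s n) =
      ∫⁻ y in Set.Icc t 1, k y * (pw l s n * ∫⁻ z, Q n z y ∂(nuM s n)) := by
    intro n
    rw [lintegral_lintegral_swap]
    · rw [← lintegral_const_mul' _ _ (by unfold pw; exact ENNReal.ofReal_ne_top)]
      refine lintegral_congr fun y => ?_
      rw [lintegral_const_mul' _ _ (hk' y)]; ring
    · exact ((hk.comp measurable_snd).mul (hQ n)).aemeasurable
  simp_rw [h1]
  rw [← lintegral_tsum]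
  · refine lintegral_congr fun y => ?_
    rw [ENNReal.tsum_mul_left]
  · intro n
    refine (hk.mul (Measurable.const_mul ?_ _)).aemeasurable
    exact Measurable.lintegral_prod_left' (hQ n)

lemma pw_succ {l s x : ℝ} (hl : 0 ≤ l) (n : ℕ) :
    pw l s (n + 1) * ((n + 1 : ℕ) : ENNReal) = ker l (x - s) * pw l x n := by
  unfold pw ker
  rw [← ENNReal.ofReal_natCast, ← ENNReal.ofReal_mul (by positivity),
    ← ENNReal.ofReal_mul (by positivity)]
  congr 1
  have : Real.exp (-(l * (1 - s))) = Real.exp (-(l * (x - s))) * Real.exp (-(l * (1 - x))) := by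
    rw [← Real.exp_add]; congr 1; ring
  rw [this, Nat.factorial_succ, pow_succ]
  push_cast
  field_simp

lemma PP_rec {l s : ℝ} (hl : 0 ≤ l) {φ : ∀ n, (Fin n → ℝ) → ENNReal} (hφ : ∀ n, Measurable (φ n))
    (hsym : ∀ n (e : Equiv.Perm (Fin n)) z, φ n (z ∘ e) = φ n z) (h0 : ∀ z, φ 0 z = 0) :
    PP l s φ = ∫⁻ x in Set.Icc s 1, ker l (x - s) *
      PP l x (fun n z => φ (n + 1) (Fin.cons x z : Fin (n + 1) → ℝ)) := by
  have hm : ∀ n, Measurable (Function.uncurry fun (x : ℝ) (z : Fin n → ℝ) =>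
      φ (n + 1) (Fin.cons x z : Fin (n + 1) → ℝ)) := fun n => (hφ (n + 1)).comp measurable_cons
  unfold PP
  rw [tsum_eq_zero_add' ENNReal.summable]
  simp only [h0, lintegral_zero, mul_zero, zero_add]
  have h1 : ∀ n, pw l s (n + 1) * ∫⁻ z, φ (n + 1) z ∂(nuM s (n + 1)) =
      ∫⁻ x in Set.Icc s 1, ker l (x - s) * (pw l x n *
        ∫⁻ z, φ (n + 1) (Fin.cons x z : Fin (n + 1) → ℝ) ∂(nuM x n)) := by
    intro n
    rw [min_decomp s n _ (hφ _) (hsym _), ← mul_assoc, ← lintegral_const_mul']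
    · refine lintegral_congr fun x => ?_
      rw [pw_succ (x := x) hl, mul_assoc]
    · unfold pw
      exact ENNReal.mul_ne_top ENNReal.ofReal_ne_top (ENNReal.natCast_ne_top _)
  simp_rw [h1]
  rw [← lintegral_tsum]
  · refine lintegral_congr fun y => ?_
    rw [ENNReal.tsum_mul_left]
  · intro n
    refine (Measurable.mul ?_ (Measurable.mul (measurable_pw l n) ?_)).aemeasurable
    · exact (measurable_ker l).comp (by fun_prop)
    · exact measurable_nuM (hm n) measurable_id

/-! ### The value function -/

/-- Matching number as an extended nonnegative real. -/
@[irreducible] noncomputable def mmE (r : ℝ) {k k' : ℕ} (X : Fin k → ℝ) (Y : Fin k' → ℝ) : ENNReal :=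
  (mmSize r X Y : ENNReal)

/-- Poissonized expected matching number, with points added at the left ends. -/
noncomputable def VV (l r x y : ℝ) : ENNReal :=
  PP l x fun a X => PP l y fun b Y =>
    mmE r (Fin.cons x X : Fin (a + 1) → ℝ) (Fin.cons y Y : Fin (b + 1) → ℝ)

/-- Poissonized expected matching number. -/
noncomputable def UU (l r x y : ℝ) : ENNReal :=
  PP l x fun _ X => PP l y fun _ Y => mmE r X Y

lemma measurable_mmE (r : ℝ) (k k' : ℕ) :
    Measurable fun p : (Fin k → ℝ) × (Fin k' → ℝ) => mmE r p.1 p.2 := by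
  unfold mmE
  exact (measurable_from_top (f := fun n : ℕ => (n : ENNReal))).comp (measurable_mm r k k')

lemma measurable_mmE_comp (r : ℝ) {k k' : ℕ} {α : Type*} [MeasurableSpace α] {f : α → Fin k → ℝ}
    {g : α → Fin k' → ℝ} (hf : Measurable f) (hg : Measurable g) :
    Measurable fun a => mmE r (f a) (g a) :=
  Measurable.comp (g := fun p : (Fin k → ℝ) × (Fin k' → ℝ) => mmE r p.1 p.2)
    (f := fun a => (f a, g a)) (measurable_mmE r k k') (hf.prodMk hg)

lemma measurable_cons_comp {n : ℕ} {α : Type*} [MeasurableSpace α] {f : α → ℝ}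
    {g : α → Fin n → ℝ} (hf : Measurable f) (hg : Measurable g) :
    Measurable fun a => (Fin.cons (f a) (g a) : Fin (n + 1) → ℝ) :=
  measurable_cons.comp (hf.prodMk hg)

lemma mmE_empty_right (r : ℝ) {k : ℕ} (X : Fin k → ℝ) (Y : Fin 0 → ℝ) : mmE r X Y = 0 := by
  have := mm_le_right r X Y
  simp [mmE]; omega

lemma mmE_empty_left (r : ℝ) {k : ℕ} (X : Fin 0 → ℝ) (Y : Fin k → ℝ) : mmE r X Y = 0 := by
  have := mm_le_left r X Y
  simp [mmE]; omega

lemma PP_zero (l s : ℝ) : PP l s (fun _ _ => 0) = 0 := by simp [PP]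

lemma inner_rec {l r : ℝ} (hl : 0 ≤ l) (y : ℝ) {k : ℕ} (X : Fin k → ℝ) :
    (PP l y fun _ Y => mmE r X Y) = ∫⁻ y' in Set.Icc y 1, ker l (y' - y) *
      PP l y' fun b Y => mmE r X (Fin.cons y' Y : Fin (b + 1) → ℝ) := by
  refine PP_rec (φ := fun _ Y => mmE r X Y) hl (fun n => ?_) (fun n e z => ?_)
    (fun z => mmE_empty_right r X z)
  · exact measurable_mmE_comp r measurable_const measurable_id
  · simp only [mmE, mm_perm_right]

lemma outer_rec {l r : ℝ} (hl : 0 ≤ l) (x y : ℝ) :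
    (PP l x fun _ X => PP l y fun b Y => mmE r X (Fin.cons y Y : Fin (b + 1) → ℝ)) =
      ∫⁻ x' in Set.Icc x 1, ker l (x' - x) * VV l r x' y := by
  refine PP_rec (φ := fun _ X => PP l y fun b Y => mmE r X (Fin.cons y Y : Fin (b + 1) → ℝ))
    hl (fun n => ?_) (fun n e z => ?_) (fun z => ?_)
  · refine measurable_PP l (s := fun _ => y) (ψ := fun b X Y => mmE r X (Fin.cons y Y : Fin (b + 1) → ℝ))
      (fun b => ?_) measurable_const
    exact measurable_mmE_comp r measurable_fst (measurable_cons_comp measurable_const measurable_snd)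
  · simp only [mmE, mm_perm]
  · simp only [mmE_empty_left, PP_zero]

lemma VV_near {l r : ℝ} (hl : 0 ≤ l) {x y : ℝ} (hx : x ≤ 1) (hy : y ≤ 1) (h : |x - y| < r) :
    VV l r x y = 1 + UU l r x y := by
  unfold VV UU
  rw [← PP_one_add hl hx]
  refine PP_congr fun a X hX => ?_
  rw [← PP_one_add hl hy]
  refine PP_congr fun b Y hY => ?_
  unfold mmE
  rw [mm_greedy r x y X Y hX hY h]
  push_cast; rfl

lemma UU_rec {l r : ℝ} (hl : 0 ≤ l) (x y : ℝ) :
    UU l r x y = ∫⁻ y' in Set.Icc y 1, ker l (y' - y) *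
      ∫⁻ x' in Set.Icc x 1, ker l (x' - x) * VV l r x' y' := by
  unfold UU
  simp_rw [inner_rec hl y]
  rw [PP_swap l x y (k := fun y' => ker l (y' - y)) (Q := fun n X y' => PP l y' fun b Y => mmE r X (Fin.cons y' Y : Fin (b + 1) → ℝ))]
  · simp_rw [outer_rec hl x]
  · exact (measurable_ker l).comp (by fun_prop)
  · intro y; unfold ker; exact ENNReal.ofReal_ne_top
  · intro n
    refine measurable_PP l (s := fun p : (Fin n → ℝ) × ℝ => p.2)
      (ψ := fun b p Y => mmE r p.1 (Fin.cons p.2 Y : Fin (b + 1) → ℝ)) (fun b => ?_) measurable_snd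
    exact measurable_mmE_comp r (measurable_fst.comp measurable_fst)
      (measurable_cons_comp (measurable_snd.comp measurable_fst) measurable_snd)

lemma VV_right {l r : ℝ} (hl : 0 ≤ l) {x y : ℝ} (h : r ≤ x - y) :
    VV l r x y = ∫⁻ y' in Set.Icc y 1, ker l (y' - y) * VV l r x y' := by
  have h1 : VV l r x y = PP l x fun a X => PP l y fun b Y =>
      mmE r (Fin.cons x X : Fin (a + 1) → ℝ) Y := by
    unfold VV
    refine PP_congr fun a X hX => ?_
    refine PP_congr fun b Y hY => ?_
    unfold mmE
    rw [mm_swap, mm_cons_isolated, mm_swap]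
    intro j
    have : x ≤ (Fin.cons x X : Fin (a + 1) → ℝ) j := by
      refine Fin.cases ?_ (fun j => ?_) j <;> simp [hX]
    rw [abs_sub_comm]
    exact le_trans (by linarith) (le_abs_self _)
  rw [h1]
  simp_rw [inner_rec hl y]
  rw [PP_swap l x y (k := fun y' => ker l (y' - y)) (Q := fun n X y' => PP l y' fun b Y =>
    mmE r (Fin.cons x X : Fin (n + 1) → ℝ) (Fin.cons y' Y : Fin (b + 1) → ℝ))]
  · rfl
  · exact (measurable_ker l).comp (by fun_prop)
  · intro y; unfold ker; exact ENNReal.ofReal_ne_top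
  · intro n
    refine measurable_PP l (s := fun p : (Fin n → ℝ) × ℝ => p.2)
      (ψ := fun b p Y => mmE r (Fin.cons x p.1 : Fin (n + 1) → ℝ) (Fin.cons p.2 Y : Fin (b + 1) → ℝ))
      (fun b => ?_) measurable_snd
    exact measurable_mmE_comp r (measurable_cons_comp measurable_const (measurable_fst.comp measurable_fst))
      (measurable_cons_comp (measurable_snd.comp measurable_fst) measurable_snd)

lemma VV_left {l r : ℝ} (hl : 0 ≤ l) {x y : ℝ} (h : r ≤ y - x) :
    VV l r x y = ∫⁻ x' in Set.Icc x 1, ker l (x' - x) * VV l r x' y := by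
  rw [← outer_rec hl]
  unfold VV
  refine PP_congr fun a X hX => ?_
  refine PP_congr fun b Y hY => ?_
  unfold mmE
  rw [mm_cons_isolated]
  intro j
  have : y ≤ (Fin.cons y Y : Fin (b + 1) → ℝ) j := by
    refine Fin.cases ?_ (fun j => ?_) j <;> simp [hY]
  rw [abs_sub_comm]
  exact le_trans (by linarith) (le_abs_self _)

lemma VV_bound {l r : ℝ} (hl : 0 ≤ l) {x y : ℝ} (hx0 : 0 ≤ x) (hx : x ≤ 1) (hy : y ≤ 1) :
    VV l r x y ≤ ENNReal.ofReal (Real.exp l) := by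
  have h1 : VV l r x y ≤ PP l x fun a _ => ENNReal.ofReal 2 ^ a := by
    unfold VV
    refine PP_mono fun a X => ?_
    have : (PP l y fun (b : ℕ) (Y : Fin b → ℝ) => ENNReal.ofReal 2 ^ a * 1) = ENNReal.ofReal 2 ^ a := by
      rw [PP_mul _ (by simp), PP_one hl hy, mul_one]
    rw [← this]
    refine PP_mono fun b Y => ?_
    have h2 := mm_le_left r (Fin.cons x X : Fin (a + 1) → ℝ) (Fin.cons y Y : Fin (b + 1) → ℝ)
    have h3 : a + 1 ≤ 2 ^ a := Nat.lt_two_pow_self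
    have h4 := h2.trans h3
    unfold mmE
    rw [mul_one, ENNReal.ofReal_ofNat]
    exact_mod_cast h4
  refine h1.trans ?_
  rw [PP_pow hl hx (by norm_num)]
  refine ENNReal.ofReal_le_ofReal (Real.exp_le_exp.2 ?_)
  nlinarith

lemma pot {l : ℝ} (hl : 0 < l) {y : ℝ} (hy : y ≤ 1) {F f : ℝ → ℝ} {S : Set ℝ} (hS : S.Countable)
    (hF : Continuous F) (hd : ∀ t, t ∉ S → HasDerivAt F (l * (F t - f t)) t) (hf : Measurable f)
    (f0 : ∀ t ∈ Set.Icc y 1, 0 ≤ f t) {B : ℝ} (hB : ∀ t ∈ Set.Icc y 1, f t ≤ B) (F1 : 0 ≤ F 1) :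
    (∫⁻ t in Set.Icc y 1, ker l (t - y) * ENNReal.ofReal (f t)) +
      ENNReal.ofReal (Real.exp (-(l * (1 - y))) * F 1) = ENNReal.ofReal (F y) := by
  set G : ℝ → ℝ := fun t => -(Real.exp (-(l * (t - y))) * F t) with hG
  set h : ℝ → ℝ := fun t => l * Real.exp (-(l * (t - y))) * f t with hh
  have hk : Continuous fun t => l * Real.exp (-(l * (t - y))) := by fun_prop
  have h0 : ∀ t ∈ Set.Icc y 1, 0 ≤ h t := fun t ht => mul_nonneg (by positivity) (f0 t ht)
  have hIntg : IntegrableOn h (Set.Icc y 1) := by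
    refine IntegrableOn.continuousOn_mul hk.continuousOn ?_ isCompact_Icc
    refine Measure.integrableOn_of_bounded (M := B) (by simp) hf.aestronglyMeasurable ?_
    filter_upwards [ae_restrict_mem measurableSet_Icc] with t ht
    rw [Real.norm_of_nonneg (f0 t ht)]
    exact hB t ht
  have e1 : ∫⁻ t in Set.Icc y 1, ker l (t - y) * ENNReal.ofReal (f t) =
      ENNReal.ofReal (∫ t in Set.Icc y 1, h t) := by
    rw [ofReal_integral_eq_lintegral_ofReal hIntg]
    · refine lintegral_congr fun t => ?_
      rw [ker, ← ENNReal.ofReal_mul (by positivity)]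
    · filter_upwards [ae_restrict_mem measurableSet_Icc] with t ht using h0 t ht
  have e2 : ∫ t in Set.Icc y 1, h t = F y - Real.exp (-(l * (1 - y))) * F 1 := by
    rw [integral_Icc_eq_integral_Ioc, ← intervalIntegral.integral_of_le hy]
    rw [integral_eq_of_hasDerivAt_off_countable G h hS (by fun_prop) (fun t ht => ?_)]
    · simp [hG]; ring
    · rw [intervalIntegrable_iff_integrableOn_Icc_of_le hy]; exact hIntg
    · have a1 : HasDerivAt (fun t => Real.exp (-(l * (t - y)))) (Real.exp (-(l * (t - y))) * (-(l * 1))) t :=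
        ((((hasDerivAt_id t).sub_const y).const_mul l).neg).exp
      refine HasDerivAt.congr_deriv (a1.mul (hd t ht.2)).neg ?_
      simp only [hh]; ring
  have e3 : 0 ≤ ∫ t in Set.Icc y 1, h t := setIntegral_nonneg measurableSet_Icc h0
  rw [e1, ← ENNReal.ofReal_add e3 (by positivity), e2]
  congr 1; ring

/-! ### The explicit potential -/

noncomputable def clip (c d : ℝ) : ℝ := max (-c) (min c d)
noncomputable def chi (c d : ℝ) : ℝ := if |d| < c then 1 else 0
noncomputable def QQ (c d : ℝ) : ℝ := d * clip c d - clip c d ^ 2 / 2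

lemma clip_cont (c : ℝ) : Continuous (clip c) := by unfold clip; fun_prop
lemma QQ_cont (c : ℝ) : Continuous (QQ c) := by
  have := clip_cont c
  unfold QQ; fun_prop

lemma chi_meas (c : ℝ) : Measurable (chi c) := by
  unfold chi
  exact Measurable.ite (measurableSet_lt (by fun_prop) measurable_const) measurable_const measurable_const

lemma clip_in {c d : ℝ} (h : |d| ≤ c) : clip c d = d := by
  have := abs_le.1 h
  unfold clip
  rw [min_eq_right this.2, max_eq_right this.1]

lemma clip_hi {c d : ℝ} (hc : 0 < c) (h : c ≤ d) : clip c d = c := by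
  unfold clip
  rw [min_eq_left h, max_eq_right (by linarith)]

lemma clip_lo {c d : ℝ} (hc : 0 < c) (h : d ≤ -c) : clip c d = -c := by
  unfold clip
  rw [min_eq_right (by linarith), max_eq_left h]

lemma clip_deriv {c d : ℝ} (hc : 0 < c) (h : |d| ≠ c) : HasDerivAt (clip c) (chi c d) d := by
  rcases lt_or_gt_of_ne h with h | h
  · rw [chi, if_pos h]
    refine (hasDerivAt_id d).congr_of_eventuallyEq ?_
    filter_upwards [(isOpen_lt continuous_abs continuous_const).mem_nhds h] with t ht
    exact clip_in (le_of_lt ht)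
  · rw [chi, if_neg (not_lt.2 h.le)]
    rcases lt_abs.1 h with h | h
    · refine (hasDerivAt_const d c).congr_of_eventuallyEq ?_
      filter_upwards [lt_mem_nhds h] with t ht
      exact clip_hi hc ht.le
    · refine (hasDerivAt_const d (-c)).congr_of_eventuallyEq ?_
      filter_upwards [gt_mem_nhds (show d < -c by linarith)] with t ht
      exact clip_lo hc ht.le

lemma QQ_deriv {c d : ℝ} (hc : 0 < c) (h : |d| ≠ c) : HasDerivAt (QQ c) (clip c d) d := by
  have h1 := clip_deriv hc h
  have h2 := ((hasDerivAt_id d).mul h1).sub ((h1.pow 2).div_const 2)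
  refine h2.congr_deriv ?_
  have : (d - clip c d) * chi c d = 0 := by
    unfold chi
    split_ifs with h3
    · rw [clip_in h3.le]; ring
    · ring
  simp only [id]
  push_cast
  linear_combination this

lemma clip_abs {c : ℝ} (hc : 0 < c) (d : ℝ) : |clip c d| ≤ c := by
  rw [abs_le]
  unfold clip
  exact ⟨le_max_left _ _, max_le (by linarith) (min_le_left _ _)⟩

lemma QQ_le {c : ℝ} (hc : 0 < c) (d : ℝ) : QQ c d ≤ c * |d| := by
  have h1 := clip_abs hc d
  have h2 : d * clip c d ≤ |d| * c := by
    refine (le_abs_self _).trans ?_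
    rw [abs_mul]
    exact mul_le_mul_of_nonneg_left h1 (abs_nonneg _)
  unfold QQ
  nlinarith [sq_nonneg (clip c d)]

lemma QQ_ge {c : ℝ} (hc : 0 < c) (d : ℝ) : c * |d| - c ^ 2 / 2 ≤ QQ c d := by
  unfold QQ
  rcases le_total (|d|) c with h | h
  · rw [clip_in h]
    nlinarith [sq_nonneg (c - |d|), sq_abs d]
  · rcases le_abs.1 h with h' | h'
    · rw [clip_hi hc h', abs_of_nonneg (by linarith)]; nlinarith
    · rw [clip_lo hc (by linarith), abs_of_nonpos (by linarith)]; nlinarith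

/-- The parameters of the potential. -/
structure Par (c g l : ℝ) : Prop where
  c0 : 0 < c
  g0 : 0 < g
  g1 : g < 1
  l0 : 0 < l
  rel : (1 - g) * c = g / 2

noncomputable def U0 (c g l x y : ℝ) : ℝ :=
  g * (2 * l - l * x - l * y) / 2 - (1 - g) * QQ c (l * (x - y))
noncomputable def v0 (c g l x y : ℝ) : ℝ :=
  U0 c g l x y + g + (1 - g) * chi c (l * (x - y))
/-- `A0 c g l σ x y` with a sign `σ = ±1`. -/
noncomputable def A0 (c g l σ x y : ℝ) : ℝ :=
  U0 c g l x y + g / 2 + σ * (1 - g) * clip c (l * (x - y))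

section
variable {c g l : ℝ} (P : Par c g l)

lemma U0_nonneg (P : Par c g l) {x y : ℝ} (hx : x ≤ 1) (hy : y ≤ 1) : 0 ≤ U0 c g l x y := by
  have h1 := QQ_le P.c0 (l * (x - y))
  have h2 := mul_le_mul_of_nonneg_left h1 (sub_nonneg.2 P.g1.le)
  have h3 : (1 - g) * (c * |l * (x - y)|) = g / 2 * (l * |x - y|) := by
    rw [abs_mul, abs_of_pos P.l0, ← mul_assoc, P.rel]
  have h4 : |x - y| ≤ 2 - x - y := abs_le.2 ⟨by linarith, by linarith⟩
  have h5 : g / 2 * (l * |x - y|) ≤ g / 2 * (l * (2 - x - y)) := by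
    have := P.g0; have := P.l0; gcongr
  unfold U0
  nlinarith

lemma U0_le (P : Par c g l) {x y : ℝ} (hx0 : 0 ≤ x) (hy0 : 0 ≤ y) : U0 c g l x y ≤ g * l + g * c / 4 := by
  have h1 := QQ_ge P.c0 (l * (x - y))
  have h2 := mul_le_mul_of_nonneg_left h1 (sub_nonneg.2 P.g1.le)
  have h3 : (1 - g) * (c * |l * (x - y)| - c ^ 2 / 2) = g / 2 * (l * |x - y|) - g * c / 4 := by
    rw [abs_mul, abs_of_pos P.l0]; linear_combination (l * |x - y| - c / 2) * P.rel
  have h4 : 0 ≤ g / 2 * (l * |x - y|) := by have := P.g0; have := P.l0; positivity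
  have h5 : 0 ≤ g * (l * x + l * y) := by have := P.g0; have := P.l0; positivity
  unfold U0
  nlinarith

lemma U0_right (P : Par c g l) {x : ℝ} (hx : x ≤ 1) : U0 c g l x 1 ≤ g * c / 4 := by
  have h1 := QQ_ge P.c0 (l * (x - 1))
  have h2 := mul_le_mul_of_nonneg_left h1 (sub_nonneg.2 P.g1.le)
  have h3 : (1 - g) * (c * |l * (x - 1)| - c ^ 2 / 2) = g / 2 * (l * (1 - x)) - g * c / 4 := by
    rw [abs_mul, abs_of_pos P.l0, abs_of_nonpos (by linarith)]
    linear_combination (l * (1 - x) - c / 2) * P.rel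
  unfold U0
  nlinarith

lemma U0_left (P : Par c g l) {x : ℝ} (hx : x ≤ 1) : U0 c g l 1 x ≤ g * c / 4 := by
  have h1 := QQ_ge P.c0 (l * (1 - x))
  have h2 := mul_le_mul_of_nonneg_left h1 (sub_nonneg.2 P.g1.le)
  have h3 : (1 - g) * (c * |l * (1 - x)| - c ^ 2 / 2) = g / 2 * (l * (1 - x)) - g * c / 4 := by
    rw [abs_mul, abs_of_pos P.l0, abs_of_nonneg (by linarith)]
    linear_combination (l * (1 - x) - c / 2) * P.rel
  unfold U0
  nlinarith

lemma A0_bd (P : Par c g l) {σ : ℝ} (hσ : |σ| = 1) (x y : ℝ) :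
    U0 c g l x y ≤ A0 c g l σ x y ∧ A0 c g l σ x y ≤ U0 c g l x y + g := by
  have h : |σ * (1 - g) * clip c (l * (x - y))| ≤ g / 2 := by
    rw [abs_mul, abs_mul, hσ, one_mul, abs_of_nonneg (sub_nonneg.2 P.g1.le), ← P.rel]
    exact mul_le_mul_of_nonneg_left (clip_abs P.c0 _) (sub_nonneg.2 P.g1.le)
  have := abs_le.1 h
  unfold A0
  constructor <;> linarith

lemma v0_bd (P : Par c g l) (x y : ℝ) :
    U0 c g l x y ≤ v0 c g l x y ∧ v0 c g l x y ≤ U0 c g l x y + 1 := by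
  have h : 0 ≤ chi c (l * (x - y)) ∧ chi c (l * (x - y)) ≤ 1 := by
    unfold chi; split_ifs <;> norm_num
  have := P.g0
  have h1 := mul_nonneg (sub_nonneg.2 P.g1.le) h.1
  have h2 := mul_le_mul_of_nonneg_left h.2 (sub_nonneg.2 P.g1.le)
  unfold v0
  constructor <;> linarith

/-- Exceptional set. -/
def ex (c l x : ℝ) : Set ℝ := {x - c / l, x + c / l}

lemma ex_countable (c l x : ℝ) : (ex c l x).Countable := by
  unfold ex
  exact Set.Countable.insert _ (Set.countable_singleton _)

lemma ex_y (P : Par c g l) {x y : ℝ} (h : y ∉ ex c l x) : |l * (x - y)| ≠ c := by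
  intro h'
  have hl := P.l0
  apply h
  unfold ex
  rcases eq_or_eq_neg_of_abs_eq h' with h1 | h1
  · left; field_simp; linarith
  · right; simp only [Set.mem_singleton_iff]; field_simp; linarith

lemma ex_x (P : Par c g l) {x y : ℝ} (h : x ∉ ex c l y) : |l * (x - y)| ≠ c := by
  have := ex_y P h
  rwa [abs_mul, abs_sub_comm, ← abs_mul] at this

lemma cont_U0_y (x : ℝ) : Continuous fun y => U0 c g l x y := by
  have := QQ_cont c
  unfold U0; fun_prop
lemma cont_U0_x (y : ℝ) : Continuous fun x => U0 c g l x y := by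
  have := QQ_cont c
  unfold U0; fun_prop
lemma cont_A0_y (σ x : ℝ) : Continuous fun y => A0 c g l σ x y := by
  have := clip_cont c
  have := cont_U0_y (c := c) (g := g) (l := l) x
  unfold A0; fun_prop
lemma cont_A0_x (σ y : ℝ) : Continuous fun x => A0 c g l σ x y := by
  have := clip_cont c
  have := cont_U0_x (c := c) (g := g) (l := l) y
  unfold A0; fun_prop
lemma meas_v0_y (x : ℝ) : Measurable fun y => v0 c g l x y := by
  have := chi_meas c
  have := (cont_U0_y (c := c) (g := g) (l := l) x).measurable
  unfold v0; fun_prop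
lemma meas_v0_x (y : ℝ) : Measurable fun x => v0 c g l x y := by
  have := chi_meas c
  have := (cont_U0_x (c := c) (g := g) (l := l) y).measurable
  unfold v0; fun_prop

lemma dd_y (x y : ℝ) : HasDerivAt (fun y => l * (x - y)) (-l) y := by
  simpa using ((hasDerivAt_id y).const_sub x).const_mul l
lemma dd_x (x y : ℝ) : HasDerivAt (fun x => l * (x - y)) l x := by
  simpa using ((hasDerivAt_id x).sub_const y).const_mul l

lemma dU_y (P : Par c g l) {x y : ℝ} (h : |l * (x - y)| ≠ c) :
    HasDerivAt (fun y => U0 c g l x y) (l * (U0 c g l x y - A0 c g l (-1) x y)) y := by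
  have h1 := (QQ_deriv P.c0 h).comp y (dd_y (l := l) x y)
  have h2 : HasDerivAt (fun y => g * (2 * l - l * x - l * y) / 2) (g * (-(l * 1)) / 2) y :=
    ((((hasDerivAt_id y).const_mul l).const_sub (2 * l - l * x)).const_mul g).div_const 2
  refine HasDerivAt.congr_deriv (h2.sub (h1.const_mul (1 - g))) ?_
  unfold A0; ring

lemma dU_x (P : Par c g l) {x y : ℝ} (h : |l * (x - y)| ≠ c) :
    HasDerivAt (fun x => U0 c g l x y) (l * (U0 c g l x y - A0 c g l 1 x y)) x := by
  have h1 := (QQ_deriv P.c0 h).comp x (dd_x (l := l) x y)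
  have h2 : HasDerivAt (fun x => g * (2 * l - l * x - l * y) / 2) (g * (-(l * 1)) / 2) x :=
    (((((hasDerivAt_id x).const_mul l).const_sub (2 * l)).sub_const (l * y)).const_mul g).div_const 2
  refine HasDerivAt.congr_deriv (h2.sub (h1.const_mul (1 - g))) ?_
  unfold A0; ring

lemma dA_y (P : Par c g l) {x y : ℝ} (h : |l * (x - y)| ≠ c) :
    HasDerivAt (fun y => A0 c g l 1 x y) (l * (A0 c g l 1 x y - v0 c g l x y)) y := by
  have h1 := (clip_deriv P.c0 h).comp y (dd_y (l := l) x y)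
  refine HasDerivAt.congr_deriv (((dU_y P h).add_const (g / 2)).add (h1.const_mul (1 * (1 - g)))) ?_
  unfold A0 v0; ring

lemma dA_x (P : Par c g l) {x y : ℝ} (h : |l * (x - y)| ≠ c) :
    HasDerivAt (fun x => A0 c g l (-1) x y) (l * (A0 c g l (-1) x y - v0 c g l x y)) x := by
  have h1 := (clip_deriv P.c0 h).comp x (dd_x (l := l) x y)
  refine HasDerivAt.congr_deriv (((dU_x P h).add_const (g / 2)).add (h1.const_mul (-1 * (1 - g)))) ?_
  unfold A0 v0; ring

/-- Boundary constant. -/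
lemma A0_end_y (P : Par c g l) {σ : ℝ} (hσ : |σ| = 1) {x : ℝ} (hx : x ≤ 1) :
    0 ≤ A0 c g l σ x 1 ∧ A0 c g l σ x 1 ≤ g * c / 4 + g := by
  have h1 := A0_bd P hσ x 1
  have h2 := U0_nonneg P hx le_rfl
  have h3 := U0_right P hx
  constructor <;> linarith
lemma A0_end_x (P : Par c g l) {σ : ℝ} (hσ : |σ| = 1) {x : ℝ} (hx : x ≤ 1) :
    0 ≤ A0 c g l σ 1 x ∧ A0 c g l σ 1 x ≤ g * c / 4 + g := by
  have h1 := A0_bd P hσ 1 x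
  have h2 := U0_nonneg P le_rfl hx
  have h3 := U0_left P hx
  constructor <;> linarith

lemma Ky_v0 (P : Par c g l) {x y : ℝ} (hx0 : 0 ≤ x) (hx : x ≤ 1) (hy0 : 0 ≤ y) (hy : y ≤ 1) :
    (∫⁻ t in Set.Icc y 1, ker l (t - y) * ENNReal.ofReal (v0 c g l x t)) +
      ENNReal.ofReal (Real.exp (-(l * (1 - y))) * A0 c g l 1 x 1) = ENNReal.ofReal (A0 c g l 1 x y) := by
  refine pot (F := fun y => A0 c g l 1 x y) (f := fun y => v0 c g l x y) (B := g * l + g * c / 4 + 1)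
    P.l0 hy (ex_countable c l x) (cont_A0_y 1 x)
    (fun t ht => dA_y P (ex_y P ht)) (meas_v0_y x) (fun t ht => ?_) (fun t ht => ?_)
    (A0_end_y P (by simp) hx).1
  · exact (U0_nonneg P hx ht.2).trans (v0_bd P x t).1
  · exact (v0_bd P x t).2.trans (by linarith [U0_le P hx0 (hy0.trans ht.1)])

lemma Kx_v0 (P : Par c g l) {x y : ℝ} (hx0 : 0 ≤ x) (hx : x ≤ 1) (hy0 : 0 ≤ y) (hy : y ≤ 1) :
    (∫⁻ t in Set.Icc x 1, ker l (t - x) * ENNReal.ofReal (v0 c g l t y)) +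
      ENNReal.ofReal (Real.exp (-(l * (1 - x))) * A0 c g l (-1) 1 y) =
      ENNReal.ofReal (A0 c g l (-1) x y) := by
  refine pot (F := fun x => A0 c g l (-1) x y) (f := fun x => v0 c g l x y)
    (B := g * l + g * c / 4 + 1) P.l0 hx (ex_countable c l y) (cont_A0_x (-1) y)
    (fun t ht => dA_x P (ex_x P ht)) (meas_v0_x y) (fun t ht => ?_) (fun t ht => ?_)
    (A0_end_x P (by simp) hy).1
  · exact (U0_nonneg P ht.2 hy).trans (v0_bd P t y).1
  · exact (v0_bd P t y).2.trans (by linarith [U0_le P (hx0.trans ht.1) hy0])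

lemma Ky_A0 (P : Par c g l) {x y : ℝ} (hx0 : 0 ≤ x) (hx : x ≤ 1) (hy0 : 0 ≤ y) (hy : y ≤ 1) :
    (∫⁻ t in Set.Icc y 1, ker l (t - y) * ENNReal.ofReal (A0 c g l (-1) x t)) +
      ENNReal.ofReal (Real.exp (-(l * (1 - y))) * U0 c g l x 1) = ENNReal.ofReal (U0 c g l x y) := by
  refine pot (F := fun y => U0 c g l x y) (f := fun y => A0 c g l (-1) x y)
    (B := g * l + g * c / 4 + g)
    P.l0 hy (ex_countable c l x) (cont_U0_y x)
    (fun t ht => dU_y P (ex_y P ht)) (cont_A0_y _ x).measurable (fun t ht => ?_) (fun t ht => ?_)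
    (U0_nonneg P hx le_rfl)
  · exact (U0_nonneg P hx ht.2).trans (A0_bd P (by simp) x t).1
  · exact (A0_bd P (by simp) x t).2.trans (by linarith [U0_le P hx0 (hy0.trans ht.1)])

lemma K_one (hl : 0 < l) {y : ℝ} (hy : y ≤ 1) :
    ∫⁻ t in Set.Icc y 1, ker l (t - y) = ENNReal.ofReal (1 - Real.exp (-(l * (1 - y)))) := by
  have h := pot (F := fun _ => 1) (f := fun _ => 1) (B := 1) (S := ∅) hl hy Set.countable_empty
    continuous_const (fun t _ => by simpa using hasDerivAt_const t (1 : ℝ)) measurable_const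
    (fun _ _ => zero_le_one) (fun _ _ => le_rfl) zero_le_one
  simp only [ENNReal.ofReal_one, mul_one] at h
  rw [ENNReal.ofReal_sub _ (Real.exp_pos _).le, ENNReal.ofReal_one, ← h,
    ENNReal.add_sub_cancel_right ENNReal.ofReal_ne_top]
end

lemma Kle {l : ℝ} (hl : 0 < l) {y : ℝ} (hy : y ≤ 1) {F G : ℝ → ENNReal} {a : ℝ} (ha : 0 ≤ a)
    (h : ∀ t ∈ Set.Icc y 1, F t ≤ G t + ENNReal.ofReal a) :
    ∫⁻ t in Set.Icc y 1, ker l (t - y) * F t ≤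
      (∫⁻ t in Set.Icc y 1, ker l (t - y) * G t) +
        ENNReal.ofReal ((1 - Real.exp (-(l * (1 - y)))) * a) := by
  have hq : Real.exp (-(l * (1 - y))) ≤ 1 := by
    rw [Real.exp_le_one_iff]; nlinarith
  have hm : Measurable fun t => ker l (t - y) := (measurable_ker l).comp (by fun_prop)
  calc ∫⁻ t in Set.Icc y 1, ker l (t - y) * F t
      ≤ ∫⁻ t in Set.Icc y 1, (ker l (t - y) * G t + ker l (t - y) * ENNReal.ofReal a) := by
        refine setLIntegral_mono' measurableSet_Icc fun t ht => ?_
        rw [← mul_add]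
        exact mul_le_mul_right (h t ht) _
    _ = _ := by
        rw [lintegral_add_right _ (hm.mul_const _), lintegral_mul_const _ hm, K_one hl hy,
          ← ENNReal.ofReal_mul (by linarith)]

lemma near_iff {c l : ℝ} (hl : 0 < l) (x y : ℝ) : |x - y| < c / l ↔ |l * (x - y)| < c := by
  rw [abs_mul, abs_of_pos hl, lt_div_iff₀ hl, mul_comm]

lemma trich {c l : ℝ} (hl : 0 < l) (x y : ℝ) :
    |x - y| < c / l ∨ (c / l ≤ x - y ∧ c ≤ l * (x - y)) ∨ (c / l ≤ y - x ∧ l * (x - y) ≤ -c) := by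
  rcases lt_or_ge (|x - y|) (c / l) with h | h
  · exact Or.inl h
  · right
    rcases le_abs.1 h with h | h
    · left; refine ⟨h, ?_⟩
      rw [div_le_iff₀ hl] at h; linarith
    · right; refine ⟨by linarith, ?_⟩
      rw [div_le_iff₀ hl] at h; linarith

section
variable {c g l : ℝ}

lemma v0_near (P : Par c g l) {x y : ℝ} (h : |x - y| < c / l) :
    v0 c g l x y = 1 + U0 c g l x y := by
  rw [near_iff P.l0] at h
  unfold v0 chi
  rw [if_pos h]; ring

lemma v0_right (P : Par c g l) {x y : ℝ} (h : c ≤ l * (x - y)) :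
    v0 c g l x y = A0 c g l 1 x y := by
  unfold v0 A0 chi
  rw [if_neg (not_lt.2 (h.trans (le_abs_self _))), clip_hi P.c0 h]
  linear_combination -P.rel

lemma v0_left (P : Par c g l) {x y : ℝ} (h : l * (x - y) ≤ -c) :
    v0 c g l x y = A0 c g l (-1) x y := by
  unfold v0 A0 chi
  rw [if_neg (not_lt.2 (le_trans (by linarith) (neg_le_abs _))), clip_lo P.c0 h]
  linear_combination -P.rel

lemma exp_facts (hl : 0 < l) {y : ℝ} (hy0 : 0 ≤ y) (hy : y ≤ 1) :
    0 < Real.exp (-(l * (1 - y))) ∧ Real.exp (-(l * (1 - y))) ≤ 1 ∧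
      1 - Real.exp (-(l * (1 - y))) ≤ 1 - Real.exp (-l) := by
  refine ⟨Real.exp_pos _, ?_, ?_⟩
  · rw [Real.exp_le_one_iff]; nlinarith
  · have : Real.exp (-l) ≤ Real.exp (-(l * (1 - y))) := Real.exp_le_exp.2 (by nlinarith)
    linarith

lemma upper_step (P : Par c g l) {e : ℝ} (he : 0 ≤ e)
    (ih : ∀ x ∈ Set.Icc (0:ℝ) 1, ∀ y ∈ Set.Icc (0:ℝ) 1,
      VV l (c / l) x y ≤ ENNReal.ofReal (v0 c g l x y) + ENNReal.ofReal e) :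
    ∀ x ∈ Set.Icc (0:ℝ) 1, ∀ y ∈ Set.Icc (0:ℝ) 1,
      VV l (c / l) x y ≤ ENNReal.ofReal (v0 c g l x y) +
        ENNReal.ofReal ((1 - Real.exp (-l)) * e) := by
  rintro x ⟨hx0, hx⟩ y ⟨hy0, hy⟩
  obtain ⟨p0, p1, p2⟩ := exp_facts P.l0 hx0 hx
  obtain ⟨q0, q1, q2⟩ := exp_facts P.l0 hy0 hy
  rcases trich (c := c) P.l0 x y with h | ⟨h, h'⟩ | ⟨h, h'⟩
  · rw [VV_near P.l0.le hx hy h, UU_rec P.l0.le, v0_near P h,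
      ENNReal.ofReal_add zero_le_one (U0_nonneg P hx hy), ENNReal.ofReal_one, add_assoc]
    gcongr
    have i1 : ∀ t ∈ Set.Icc y 1, ∫⁻ x' in Set.Icc x 1, ker l (x' - x) * VV l (c / l) x' t ≤
        ENNReal.ofReal (A0 c g l (-1) x t) + ENNReal.ofReal ((1 - Real.exp (-l)) * e) := by
      intro t ht
      refine (Kle P.l0 hx he fun x' hx' => ih x' ⟨hx0.trans hx'.1, hx'.2⟩ t ⟨hy0.trans ht.1, ht.2⟩).trans ?_
      rw [← Kx_v0 P hx0 hx (hy0.trans ht.1) ht.2]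
      refine add_le_add le_self_add (ENNReal.ofReal_le_ofReal ?_)
      gcongr
    have hr : 0 ≤ (1 - Real.exp (-l)) * e := mul_nonneg (by linarith) he
    refine (Kle P.l0 hy hr i1).trans ?_
    rw [← Ky_A0 P hx0 hx hy0 hy]
    refine add_le_add le_self_add (ENNReal.ofReal_le_ofReal ?_)
    nlinarith
  · rw [VV_right P.l0.le h, v0_right P h', ← Ky_v0 P hx0 hx hy0 hy]
    refine (Kle P.l0 hy he fun t ht => ih x ⟨hx0, hx⟩ t ⟨hy0.trans ht.1, ht.2⟩).trans ?_
    refine add_le_add le_self_add (ENNReal.ofReal_le_ofReal ?_)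
    gcongr
  · rw [VV_left P.l0.le h, v0_left P h', ← Kx_v0 P hx0 hx hy0 hy]
    refine (Kle P.l0 hx he fun t ht => ih t ⟨hx0.trans ht.1, ht.2⟩ y ⟨hy0, hy⟩).trans ?_
    refine add_le_add le_self_add (ENNReal.ofReal_le_ofReal ?_)
    gcongr

lemma lower_step (P : Par c g l) {e M : ℝ} (he : 0 ≤ e) (hM : M = g * c / 4 + g)
    (ih : ∀ x ∈ Set.Icc (0:ℝ) 1, ∀ y ∈ Set.Icc (0:ℝ) 1,
      ENNReal.ofReal (v0 c g l x y) ≤ VV l (c / l) x y + ENNReal.ofReal (2 * M + e)) :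
    ∀ x ∈ Set.Icc (0:ℝ) 1, ∀ y ∈ Set.Icc (0:ℝ) 1,
      ENNReal.ofReal (v0 c g l x y) ≤ VV l (c / l) x y +
        ENNReal.ofReal (2 * M + (1 - Real.exp (-l)) * e) := by
  have hM0 : 0 ≤ M := by have := P.g0; have := P.c0; rw [hM]; positivity
  have hMe : 0 ≤ 2 * M + e := by positivity
  rintro x ⟨hx0, hx⟩ y ⟨hy0, hy⟩
  obtain ⟨p0, p1, p2⟩ := exp_facts P.l0 hx0 hx
  obtain ⟨q0, q1, q2⟩ := exp_facts P.l0 hy0 hy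
  rcases trich (c := c) P.l0 x y with h | ⟨h, h'⟩ | ⟨h, h'⟩
  · rw [VV_near P.l0.le hx hy h, UU_rec P.l0.le, v0_near P h,
      ENNReal.ofReal_add zero_le_one (U0_nonneg P hx hy), ENNReal.ofReal_one, add_assoc]
    gcongr
    set p := Real.exp (-(l * (1 - x)))
    set q := Real.exp (-(l * (1 - y)))
    have hh : 0 ≤ (1 - p) * (2 * M + e) + p * M :=
      add_nonneg (mul_nonneg (by linarith) hMe) (by positivity)
    have i1 : ∀ t ∈ Set.Icc y 1, ENNReal.ofReal (A0 c g l (-1) x t) ≤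
        (∫⁻ x' in Set.Icc x 1, ker l (x' - x) * VV l (c / l) x' t) +
          ENNReal.ofReal ((1 - p) * (2 * M + e) + p * M) := by
      intro t ht
      rw [← Kx_v0 P hx0 hx (hy0.trans ht.1) ht.2,
        ENNReal.ofReal_add (mul_nonneg (by linarith) hMe) (by positivity), ← add_assoc]
      refine add_le_add ?_ (ENNReal.ofReal_le_ofReal ?_)
      · exact Kle P.l0 hx hMe fun x' hx' => ih x' ⟨hx0.trans hx'.1, hx'.2⟩ t ⟨hy0.trans ht.1, ht.2⟩
      · rw [hM]
        exact mul_le_mul_of_nonneg_left (A0_end_x P (by simp) ht.2).2 p0.le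
    rw [← Ky_A0 P hx0 hx hy0 hy]
    refine (add_le_add_left (Kle P.l0 hy hh i1) _).trans ?_
    rw [add_assoc, ← ENNReal.ofReal_add (mul_nonneg (by linarith) hh)
      (mul_nonneg q0.le (U0_nonneg P hx le_rfl))]
    refine add_le_add le_rfl (ENNReal.ofReal_le_ofReal ?_)
    have h1 : q * U0 c g l x 1 ≤ q * M := by
      refine mul_le_mul_of_nonneg_left ?_ q0.le
      have := U0_right P hx; have := P.g0; linarith
    have h2 : (1 - q) * (1 - p) * e ≤ (1 - Real.exp (-l)) * e := by
      refine mul_le_mul_of_nonneg_right ?_ he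
      nlinarith
    have h3 : 0 ≤ p * (1 - q) * M := mul_nonneg (mul_nonneg p0.le (by linarith)) hM0
    have h4 : 0 ≤ q * M := mul_nonneg q0.le hM0
    nlinarith
  · rw [VV_right P.l0.le h, v0_right P h', ← Ky_v0 P hx0 hx hy0 hy]
    refine (add_le_add_left (Kle P.l0 hy hMe fun t ht => ih x ⟨hx0, hx⟩ t ⟨hy0.trans ht.1, ht.2⟩) _).trans ?_
    have hA := A0_end_y P (σ := 1) (by simp) hx
    rw [add_assoc, ← ENNReal.ofReal_add (mul_nonneg (by linarith) hMe) (mul_nonneg q0.le hA.1)]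
    refine add_le_add le_rfl (ENNReal.ofReal_le_ofReal ?_)
    have h1 := mul_le_mul_of_nonneg_left hA.2 q0.le
    rw [← hM] at h1
    have h2 := mul_le_mul_of_nonneg_right q2 he
    have h4 := mul_nonneg q0.le hM0
    nlinarith
  · rw [VV_left P.l0.le h, v0_left P h', ← Kx_v0 P hx0 hx hy0 hy]
    refine (add_le_add_left (Kle P.l0 hx hMe fun t ht => ih t ⟨hx0.trans ht.1, ht.2⟩ y ⟨hy0, hy⟩) _).trans ?_
    have hA := A0_end_x P (σ := -1) (by simp) hy
    rw [add_assoc, ← ENNReal.ofReal_add (mul_nonneg (by linarith) hMe) (mul_nonneg p0.le hA.1)]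
    refine add_le_add le_rfl (ENNReal.ofReal_le_ofReal ?_)
    have h1 := mul_le_mul_of_nonneg_left hA.2 p0.le
    rw [← hM] at h1
    have h2 := mul_le_mul_of_nonneg_right p2 he
    have h4 := mul_nonneg p0.le hM0
    nlinarith

lemma rho_facts (hl : 0 < l) : 0 ≤ 1 - Real.exp (-l) ∧ 1 - Real.exp (-l) < 1 := by
  have h1 := Real.exp_pos (-l)
  have h2 : Real.exp (-l) ≤ 1 := by rw [Real.exp_le_one_iff]; linarith
  constructor <;> linarith

lemma tendsto_err (hl : 0 < l) (a B : ℝ) :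
    Filter.Tendsto (fun n : ℕ => ENNReal.ofReal (a + (1 - Real.exp (-l)) ^ n * B)) Filter.atTop
      (nhds (ENNReal.ofReal a)) := by
  have h := rho_facts hl
  have h1 := (tendsto_pow_atTop_nhds_zero_of_lt_one h.1 h.2).mul_const B
  have h2 := h1.const_add a
  rw [zero_mul, add_zero] at h2
  exact ENNReal.tendsto_ofReal h2

lemma upper (P : Par c g l) : VV l (c / l) 0 0 ≤ ENNReal.ofReal (1 + g * l) := by
  have h := rho_facts P.l0
  have key : ∀ n : ℕ, ∀ x ∈ Set.Icc (0:ℝ) 1, ∀ y ∈ Set.Icc (0:ℝ) 1,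
      VV l (c / l) x y ≤ ENNReal.ofReal (v0 c g l x y) +
        ENNReal.ofReal (0 + (1 - Real.exp (-l)) ^ n * Real.exp l) := by
    intro n
    induction n with
    | zero =>
      intro x hx y hy
      refine (VV_bound P.l0.le hx.1 hx.2 hy.2).trans ?_
      simp
    | succ n ih =>
      have := upper_step P (by have := h.1; positivity) ih
      intro x hx y hy
      refine (this x hx y hy).trans (le_of_eq ?_)
      congr 2; ring
  have := ge_of_tendsto' ((tendsto_err P.l0 0 (Real.exp l)).const_add (ENNReal.ofReal (v0 c g l 0 0)))
    (fun n => key n 0 (by simp) 0 (by simp))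
  rw [ENNReal.ofReal_zero, add_zero, v0_near P (by simpa using div_pos P.c0 P.l0)] at this
  refine this.trans (le_of_eq ?_)
  congr 1
  simp [U0, QQ, clip, P.c0.le]; ring

lemma lower (P : Par c g l) :
    ENNReal.ofReal (1 + g * l) ≤ VV l (c / l) 0 0 + ENNReal.ofReal (2 * (g * c / 4 + g)) := by
  have h := rho_facts P.l0
  have hg := P.g0
  have hc := P.c0
  have hl := P.l0
  set B := g * l + g * c / 4 + 1 with hB
  have hB0 : 0 ≤ B := by positivity
  have key : ∀ n : ℕ, ∀ x ∈ Set.Icc (0:ℝ) 1, ∀ y ∈ Set.Icc (0:ℝ) 1,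
      ENNReal.ofReal (v0 c g l x y) ≤ VV l (c / l) x y +
        ENNReal.ofReal (2 * (g * c / 4 + g) + (1 - Real.exp (-l)) ^ n * B) := by
    intro n
    induction n with
    | zero =>
      intro x hx y hy
      refine le_trans (ENNReal.ofReal_le_ofReal ?_) le_add_self
      have h1 := (v0_bd P x y).2
      have h2 := U0_le P hx.1 hy.1
      have : 0 ≤ 2 * (g * c / 4 + g) := by positivity
      simp only [pow_zero, one_mul]
      linarith
    | succ n ih =>
      have := lower_step P (by have := h.1; positivity) rfl ih
      intro x hx y hy
      refine (this x hx y hy).trans (le_of_eq ?_)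
      congr 2; ring
  have := ge_of_tendsto' ((tendsto_err P.l0 (2 * (g * c / 4 + g)) B).const_add (VV l (c / l) 0 0))
    (fun n => key n 0 (by simp) 0 (by simp))
  rw [v0_near P (by simpa using div_pos P.c0 P.l0)] at this
  refine le_trans (le_of_eq ?_) this
  congr 1
  simp [U0, QQ, clip, P.c0.le]; ring
end

lemma nuM_zero (n : ℕ) : nuM 0 n = unifCube n := rfl

/-- Expected matching number. -/
noncomputable def FF (r : ℝ) (a b : ℕ) : ENNReal :=
  ∫⁻ X, ∫⁻ Y, mmE r X Y ∂(unifCube b) ∂(unifCube a)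

lemma meas_inner (r : ℝ) (a b : ℕ) :
    Measurable fun X : Fin a → ℝ => ∫⁻ Y, mmE r X Y ∂(unifCube b) :=
  (measurable_mmE r a b).lintegral_prod_right'

lemma UU_eq (l r : ℝ) : UU l r 0 0 = ∑' a, ∑' b, pw l 0 a * (pw l 0 b * FF r a b) := by
  unfold UU PP
  refine tsum_congr fun a => ?_
  rw [ENNReal.tsum_mul_left]
  congr 1
  rw [lintegral_tsum]
  · refine tsum_congr fun b => ?_
    rw [lintegral_const_mul' _ _ (by unfold pw; exact ENNReal.ofReal_ne_top)]
    rfl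
  · intro b
    exact ((meas_inner r a b).const_mul _).aemeasurable

lemma FF_swap (r : ℝ) (a b : ℕ) : FF r a b = FF r b a := by
  unfold FF
  rw [lintegral_lintegral_swap (measurable_mmE r a b).aemeasurable]
  refine lintegral_congr fun Y => lintegral_congr fun X => ?_
  unfold mmE
  rw [mm_swap]

lemma FF_cons (r : ℝ) (a b : ℕ) : FF r (a + 1) b =
    ∫⁻ x in Set.Icc (0:ℝ) 1, ∫⁻ X, ∫⁻ Y, mmE r (Fin.cons x X : Fin (a + 1) → ℝ) Y
      ∂(unifCube b) ∂(unifCube a) :=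
  lintegral_cons _ a (meas_inner r (a + 1) b)

lemma FF_le_succ (r : ℝ) (a b : ℕ) : FF r a b ≤ FF r (a + 1) b := by
  rw [FF_cons]
  have : FF r a b = ∫⁻ x in Set.Icc (0:ℝ) 1, FF r a b := by simp
  rw [this]
  unfold FF
  refine lintegral_mono fun x => lintegral_mono fun X => lintegral_mono fun Y => ?_
  have h : mmE r X Y ≤ mmE r (Fin.cons x X : Fin (a + 1) → ℝ) Y := by
    unfold mmE
    exact Nat.cast_le.2 (mm_le_cons r x X Y)
  exact h

lemma FF_succ_le (r : ℝ) (a b : ℕ) : FF r (a + 1) b ≤ FF r a b + 1 := by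
  rw [FF_cons]
  have : FF r a b + 1 = ∫⁻ x in Set.Icc (0:ℝ) 1, ∫⁻ X, ∫⁻ Y, (mmE r X Y + 1)
      ∂(unifCube b) ∂(unifCube a) := by
    simp [FF, lintegral_add_right]
  rw [this]
  refine lintegral_mono fun x => lintegral_mono fun X => lintegral_mono fun Y => ?_
  have h : mmE r (Fin.cons x X : Fin (a + 1) → ℝ) Y ≤ mmE r X Y + 1 := by
    unfold mmE
    have := Nat.cast_le (α := ENNReal).2 (mm_cons_le r x X Y)
    rwa [Nat.cast_add, Nat.cast_one] at this
  exact h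

lemma FF_add (r : ℝ) (a b k : ℕ) : FF r a b ≤ FF r (a + k) b ∧ FF r (a + k) b ≤ FF r a b + k := by
  induction k with
  | zero => simp
  | succ k ih =>
    refine ⟨ih.1.trans (FF_le_succ r (a + k) b), (FF_succ_le r (a + k) b).trans ?_⟩
    push_cast
    rw [← add_assoc]
    gcongr
    exact ih.2

/-- Distance of naturals. -/
noncomputable def nd (a N : ℕ) : ENNReal := ENNReal.ofReal |(a : ℝ) - N|

lemma FF_dist (r : ℝ) (a a' b : ℕ) : FF r a b ≤ FF r a' b + nd a a' := by
  rcases le_total a a' with h | h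
  · obtain ⟨k, rfl⟩ := Nat.exists_eq_add_of_le h
    exact (FF_add r a b k).1.trans le_self_add
  · obtain ⟨k, rfl⟩ := Nat.exists_eq_add_of_le h
    refine (FF_add r a' b k).2.trans ?_
    unfold nd
    simp

lemma nd_comm (a b : ℕ) : nd a b = nd b a := by unfold nd; rw [abs_sub_comm]

lemma FF_dist2 (r : ℝ) (a b a' b' : ℕ) : FF r a b ≤ FF r a' b' + (nd a a' + nd b b') := by
  have h1 := FF_dist r a a' b
  have h2 := FF_dist r b b' a'
  rw [FF_swap r b a', FF_swap r b' a'] at h2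
  calc _ ≤ _ := h1
    _ ≤ FF r a' b' + nd b b' + nd a a' := by gcongr
    _ = _ := by ring

lemma pw_sum {l : ℝ} (hl : 0 ≤ l) : ∑' a, pw l 0 a = 1 := by
  have := PP_one hl (zero_le_one : (0:ℝ) ≤ 1)
  unfold PP at this
  simpa [nuM_univ] using this

/-- Mean absolute deviation. -/
noncomputable def mad (N : ℕ) : ENNReal := ∑' a, pw N 0 a * nd a N

lemma dsum {p D : ℕ → ENNReal} (hp : ∑' a, p a = 1) :
    ∑' a, ∑' b, p a * (p b * (D a + D b)) = ∑' a, p a * D a + ∑' a, p a * D a := by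
  have : ∀ a b, p a * (p b * (D a + D b)) = (p a * D a) * p b + p a * (p b * D b) := by
    intros; ring
  simp_rw [this, ENNReal.tsum_add, ENNReal.tsum_mul_left, ENNReal.tsum_mul_right, hp]
  simp

lemma depo1 (r : ℝ) (N : ℕ) : FF r N N ≤ UU N r 0 0 + (mad N + mad N) := by
  have hp := pw_sum (l := N) (by positivity)
  unfold mad
  rw [UU_eq, ← dsum hp]
  calc FF r N N = ∑' a, ∑' b, pw N 0 a * (pw N 0 b * FF r N N) := by
        simp_rw [ENNReal.tsum_mul_left, ENNReal.tsum_mul_right, hp]; simp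
    _ ≤ ∑' a, ∑' b, (pw N 0 a * (pw N 0 b * FF r a b) +
        pw N 0 a * (pw N 0 b * (nd a N + nd b N))) := by
        refine ENNReal.tsum_le_tsum fun a => ENNReal.tsum_le_tsum fun b => ?_
        rw [← mul_add, ← mul_add, nd_comm a, nd_comm b]
        gcongr
        exact FF_dist2 r N N a b
    _ = _ := by simp_rw [ENNReal.tsum_add]

lemma depo2 (r : ℝ) (N : ℕ) : UU N r 0 0 ≤ FF r N N + (mad N + mad N) := by
  have hp := pw_sum (l := N) (by positivity)
  unfold mad
  rw [UU_eq, ← dsum hp]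
  calc ∑' a, ∑' b, pw N 0 a * (pw N 0 b * FF r a b)
    _ ≤ ∑' a, ∑' b, (pw N 0 a * (pw N 0 b * FF r N N) +
        pw N 0 a * (pw N 0 b * (nd a N + nd b N))) := by
        refine ENNReal.tsum_le_tsum fun a => ENNReal.tsum_le_tsum fun b => ?_
        rw [← mul_add, ← mul_add]
        gcongr
        exact FF_dist2 r a b N N
    _ = _ := by
        simp_rw [ENNReal.tsum_add, ENNReal.tsum_mul_left, ENNReal.tsum_mul_right, hp]; simp

lemma pois0 (x : ℝ) : HasSum (fun n : ℕ => x ^ n / n.factorial) (Real.exp x) := by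
  have := NormedSpace.expSeries_div_hasSum_exp (𝔸 := ℝ) x
  rwa [← Real.exp_eq_exp_ℝ] at this

lemma pois1 (x : ℝ) : HasSum (fun n : ℕ => (n : ℝ) * (x ^ n / n.factorial)) (x * Real.exp x) := by
  have h := (pois0 x).mul_left x
  refine (hasSum_nat_add_iff' 1).1 ?_
  simp only [Finset.range_one, Finset.sum_singleton, Nat.cast_zero, zero_mul, sub_zero]
  refine h.congr_fun ?_
  intro n
  rw [Nat.factorial_succ]
  push_cast
  field_simp
  ring

lemma pois2 (x : ℝ) : HasSum (fun n : ℕ => (n : ℝ) ^ 2 * (x ^ n / n.factorial))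
    (x * (x * Real.exp x + Real.exp x)) := by
  have h := ((pois1 x).add (pois0 x)).mul_left x
  refine (hasSum_nat_add_iff' 1).1 ?_
  simp only [Finset.range_one, Finset.sum_singleton, Nat.cast_zero]
  norm_num
  refine h.congr_fun ?_
  intro n
  rw [Nat.factorial_succ]
  push_cast
  field_simp
  ring

lemma mad_le (N : ℕ) (hN : 0 < N) : mad N ≤ ENNReal.ofReal (Real.sqrt N) := by
  have hN' : (0:ℝ) < N := by exact_mod_cast hN
  set s := Real.sqrt N with hs
  have hs0 : 0 < s := Real.sqrt_pos.2 hN'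
  have hss : s * s = N := Real.mul_self_sqrt hN'.le
  have hb : ∀ a : ℕ, pw N 0 a * nd a N ≤ ENNReal.ofReal
      (Real.exp (-N) * (((N:ℝ) ^ a / a.factorial) * ((s + ((a:ℝ) - N) ^ 2 / s) / 2))) := by
    intro a
    unfold pw nd
    rw [← ENNReal.ofReal_mul (by positivity)]
    refine ENNReal.ofReal_le_ofReal ?_
    have h1 : |(a:ℝ) - N| ≤ (s + ((a:ℝ) - N) ^ 2 / s) / 2 := by
      rw [le_div_iff₀ (by norm_num), ← sub_nonneg]
      have : s + ((a:ℝ) - N) ^ 2 / s - |(a:ℝ) - N| * 2 = (s - |(a:ℝ) - N|) ^ 2 / s := by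
        field_simp
        rw [← sq_abs ((a:ℝ) - N)]; ring
      rw [this]; positivity
    have h2 : 0 ≤ (N:ℝ) ^ a / a.factorial * Real.exp (-N) := by positivity
    calc _ = (N:ℝ) ^ a / a.factorial * Real.exp (-N) * |(a:ℝ) - N| := by simp
      _ ≤ (N:ℝ) ^ a / a.factorial * Real.exp (-N) * ((s + ((a:ℝ) - N) ^ 2 / s) / 2) :=
        mul_le_mul_of_nonneg_left h1 h2
      _ = _ := by ring
  have hsum : HasSum (fun a : ℕ =>
      (Real.exp (-N) * (((N:ℝ) ^ a / a.factorial) * ((s + ((a:ℝ) - N) ^ 2 / s) / 2)))) s := by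
    have e0 := (pois0 (N:ℝ)).mul_left ((s + N ^ 2 / s) / 2)
    have e1 := (pois1 (N:ℝ)).mul_left (-(N / s))
    have e2 := (pois2 (N:ℝ)).mul_left (1 / s / 2)
    have e := ((e0.add e1).add e2).mul_left (Real.exp (-N))
    have hv : Real.exp (-N) * ((s + N ^ 2 / s) / 2 * Real.exp N + -(N / s) * (N * Real.exp N) +
        1 / s / 2 * (N * (N * Real.exp N + Real.exp N))) = s := by
      have : Real.exp (-(N:ℝ)) * Real.exp N = 1 := by rw [← Real.exp_add]; simp
      have h3 : (N:ℝ) / s = s := by rw [← hss]; field_simp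
      calc _ = (Real.exp (-(N:ℝ)) * Real.exp N) * ((s + N / s) / 2) := by ring
        _ = s := by rw [this, h3]; ring
    rw [hv] at e
    refine e.congr_fun fun a => ?_
    ring
  unfold mad
  refine (ENNReal.tsum_le_tsum hb).trans ?_
  rw [← ENNReal.ofReal_tsum_of_nonneg (fun n => by positivity) hsum.summable, hsum.tsum_eq]

lemma FF_real (r : ℝ) (N : ℕ) : FF r N N = ENNReal.ofReal
    (∫ p, (mmSize r p.1 p.2 : ℝ) ∂((unifCube N).prod (unifCube N))) := by
  rw [ofReal_integral_eq_lintegral_ofReal]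
  · rw [lintegral_prod _ (by exact ((measurable_mmR r N N).ennreal_ofReal).aemeasurable)]
    unfold FF mmE
    simp
  · exact bdd_integrable _ (measurable_mmR r N N) (fun p => mm_abs_le r p.1 p.2)
  · exact Filter.Eventually.of_forall fun p => by positivity

lemma mean_bound {c : ℝ} (hc : 0 < c) {N : ℕ} (hN : 0 < N) :
    |(∫ p, (mmSize (c / N) p.1 p.2 : ℝ) ∂((unifCube N).prod (unifCube N))) - c / (c + 1 / 2) * N| ≤
      2 * Real.sqrt N + 2 * (c / 4 + 1) := by
  have hN' : (0:ℝ) < N := by exact_mod_cast hN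
  set g := c / (c + 1 / 2) with hg
  have hg0 : 0 < g := by positivity
  have hg1 : g < 1 := by rw [hg, div_lt_one (by positivity)]; linarith
  have P : Par c g N := ⟨hc, hg0, hg1, hN', by rw [hg]; field_simp; ring⟩
  set m := ∫ p, (mmSize (c / N) p.1 p.2 : ℝ) ∂((unifCube N).prod (unifCube N)) with hm
  have hm0 : 0 ≤ m := integral_nonneg fun p => by positivity
  have hF : FF (c / N) N N = ENNReal.ofReal m := FF_real _ N
  have hV : VV N (c / N) 0 0 = 1 + UU N (c / N) 0 0 :=
    VV_near hN'.le zero_le_one zero_le_one (by simpa using div_pos hc hN')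
  have hs0 := Real.sqrt_nonneg (N:ℝ)
  have hmad : mad N + mad N ≤ ENNReal.ofReal (2 * Real.sqrt N) := by
    rw [two_mul, ENNReal.ofReal_add hs0 hs0]
    exact add_le_add (mad_le N hN) (mad_le N hN)
  have u := upper P
  have lo := lower P
  rw [hV] at u lo
  have d1 := (depo1 (c / N) N).trans (add_le_add le_rfl hmad)
  have d2 := (depo2 (c / N) N).trans (add_le_add le_rfl hmad)
  rw [hF] at d1 d2
  have hk : g * c / 4 + g ≤ c / 4 + 1 := by nlinarith
  have hk0 : 0 ≤ 2 * (g * c / 4 + g) := by positivity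
  rw [abs_le]
  constructor
  · have h1 : ENNReal.ofReal (1 + g * N) ≤
        ENNReal.ofReal (1 + (m + 2 * Real.sqrt N) + 2 * (g * c / 4 + g)) := by
      refine lo.trans ?_
      rw [ENNReal.ofReal_add (by positivity) hk0, ENNReal.ofReal_add zero_le_one (by positivity),
        ENNReal.ofReal_add hm0 (by positivity), ENNReal.ofReal_one]
      gcongr
    rw [ENNReal.ofReal_le_ofReal_iff (by positivity)] at h1
    linarith
  · have h1 : ENNReal.ofReal (1 + m) ≤ ENNReal.ofReal (1 + g * N + 2 * Real.sqrt N) := by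
      rw [ENNReal.ofReal_add zero_le_one hm0, ENNReal.ofReal_add (by positivity) (by positivity),
        ENNReal.ofReal_one]
      calc 1 + ENNReal.ofReal m ≤ 1 + (UU N (c / N) 0 0 + ENNReal.ofReal (2 * Real.sqrt N)) := by gcongr
        _ = 1 + UU N (c / N) 0 0 + ENNReal.ofReal (2 * Real.sqrt N) := by ring
        _ ≤ _ := by gcongr
    rw [ENNReal.ofReal_le_ofReal_iff (by positivity)] at h1
    linarith

/-- There is `C > 0`, depending only on `c`, such that for every `N ≥ 2`, with
probability at least `1 - C/N`, `|m*(c,N) - (c/(c+1/2))·N| ≤ C·√(N·log N)`. -/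
theorem stmt4 (c : ℝ) (hc : 0 < c) :
    ∃ C : ℝ, 0 < C ∧ ∀ N : ℕ, 2 ≤ N →
      ENNReal.ofReal (1 - C / N) ≤
        ((unifCube N).prod (unifCube N))
          {ω | |(mmSize (c / N) ω.1 ω.2 : ℝ) - (c / (c + 1/2)) * N| ≤
            C * Real.sqrt (N * Real.log N)} := by
  have hl2 : 0 < Real.log 2 := Real.log_pos (by norm_num)
  set q := Real.sqrt (Real.log 2) with hq
  have hq0 : 0 < q := Real.sqrt_pos.2 hl2
  set K := 2 * (c / 4 + 1) with hK
  have hK0 : 0 ≤ K := by positivity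
  have hKq : 0 ≤ (2 + K) / q := by positivity
  refine ⟨2 + (2 + K) / q, by positivity, fun N hN => ?_⟩
  have hN0 : 0 < N := by omega
  have hN2 : (2:ℝ) ≤ N := by exact_mod_cast hN
  have hlog : Real.log 2 ≤ Real.log N := Real.log_le_log (by norm_num) hN2
  set L := Real.sqrt (N * Real.log N) with hL
  have hL0 : 0 ≤ L := Real.sqrt_nonneg _
  have hLL : L ^ 2 = N * Real.log N := Real.sq_sqrt (mul_nonneg (by linarith) (by linarith))
  have hsL : Real.sqrt N * q ≤ L := by
    rw [hq, ← Real.sqrt_mul (by linarith)]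
    exact Real.sqrt_le_sqrt (by gcongr)
  have hs1 : 1 ≤ Real.sqrt N := by rw [Real.one_le_sqrt]; linarith
  have hmean := mean_bound hc hN0
  have hconc := mm_conc (c / N) N hN0 (2 * L) (by positivity)
  set m := ∫ p, (mmSize (c / N) p.1 p.2 : ℝ) ∂((unifCube N).prod (unifCube N)) with hm
  set μ := (unifCube N).prod (unifCube N) with hμ
  have hexp : 2 * Real.exp (-(2 * L) ^ 2 / (4 * N)) = 2 / N := by
    have : -(2 * L) ^ 2 / (4 * N) = - Real.log N := by
      rw [mul_pow, hLL]; field_simp; ring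
    rw [this, Real.exp_neg, Real.exp_log (by linarith)]; rfl
  rw [hexp] at hconc
  set Bad := {p : (Fin N → ℝ) × (Fin N → ℝ) | 2 * L ≤ |(mmSize (c / N) p.1 p.2 : ℝ) - m|} with hBad
  set S := {ω : (Fin N → ℝ) × (Fin N → ℝ) |
    |(mmSize (c / N) ω.1 ω.2 : ℝ) - (c / (c + 1/2)) * N| ≤ (2 + (2 + K) / q) * L} with hS
  have hcov : Set.univ ⊆ S ∪ Bad := by
    intro p _
    by_cases hp : p ∈ Bad
    · exact Or.inr hp
    · left
      have hp' : |(mmSize (c / N) p.1 p.2 : ℝ) - m| < 2 * L := not_le.1 hp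
      have h1 := abs_sub_le (mmSize (c / N) p.1 p.2 : ℝ) m (c / (c + 1/2) * N)
      have h2 : 2 * Real.sqrt N + K ≤ (2 + K) / q * L := by
        rw [div_mul_eq_mul_div, le_div_iff₀ hq0]
        calc (2 * Real.sqrt N + K) * q ≤ ((2 + K) * Real.sqrt N) * q := by
              refine mul_le_mul_of_nonneg_right ?_ hq0.le
              nlinarith
          _ = (2 + K) * (Real.sqrt N * q) := by ring
          _ ≤ _ := by gcongr
      change |(mmSize (c / N) p.1 p.2 : ℝ) - (c / (c + 1/2)) * N| ≤ (2 + (2 + K) / q) * L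
      rw [add_mul]
      linarith
  have h1 : 1 ≤ μ S + μ Bad := by
    calc 1 = μ Set.univ := by simp [hμ]
      _ ≤ _ := (measure_mono hcov).trans (measure_union_le _ _)
  have h2 : μ Bad ≤ ENNReal.ofReal (2 / N) := by
    rw [← ENNReal.ofReal_toReal (measure_ne_top μ Bad)]
    exact ENNReal.ofReal_le_ofReal hconc
  calc ENNReal.ofReal (1 - (2 + (2 + K) / q) / N) ≤ ENNReal.ofReal (1 - 2 / N) := by
        refine ENNReal.ofReal_le_ofReal ?_
        gcongr
        linarith
    _ = 1 - ENNReal.ofReal (2 / N) := by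
        rw [ENNReal.ofReal_sub _ (by positivity), ENNReal.ofReal_one]
    _ ≤ μ S := by
        rw [tsub_le_iff_right]
        exact h1.trans (by gcongr)
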